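/- Let r be a power of p and m = (m_j)_{j≥0} an integer sequence with m_0 = 1 and m_j ≥ 2 for all j ≥ 1. Then the type of ξ(r,m) satisfies limsup_{j→∞} (2 m_j − 1) ≤ t(ξ(r,m)) ≤ limsup_{j→∞} (2 m_j + 2 m_j m_{j+1} ⋯ m_{j+p}). -/

import Mathlib

open Polynomial Filter Set
open scoped Classical

noncomputable section

namespace OotoT

variable (Fq : Type) [Field Fq]

/-- We model the field `F_q((T⁻¹))` of Laurent series in `T⁻¹` as `LaurentSeries Fq`,
whose canonical variable `u` plays the role of `T⁻¹`.  Thus `T` itself is `u⁻¹`. -/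
def Tel : LaurentSeries Fq := (HahnSeries.single (1 : ℤ) (1 : Fq))⁻¹

/-- The canonical ring embedding `F_q[T] → F_q((T⁻¹))`, sending `T ↦ u⁻¹`. -/
def ringHomT : Polynomial Fq →+* LaurentSeries Fq :=
  Polynomial.eval₂RingHom (HahnSeries.C : Fq →+* LaurentSeries Fq) (Tel Fq)

/-- The absolute value on `F_q((T⁻¹))`: `|0| = 0` and `|ξ| = q^{-N}` where
`ξ = Σ_{n ≥ N} a_n T^{-n}` with `a_N ≠ 0`; in our model `N` is the order of `ξ`
as a Hahn series in `u = T⁻¹`. -/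
def absL (q : ℕ) (ξ : LaurentSeries Fq) : ℝ :=
  if ξ = 0 then 0 else (q : ℝ) ^ (-ξ.order)

/-- Evaluation of a polynomial `P(X) ∈ (F_q[T])[X]` at `ξ ∈ F_q((T⁻¹))`. -/
def evalP (ξ : LaurentSeries Fq) (P : Polynomial (Polynomial Fq)) : LaurentSeries Fq :=
  Polynomial.eval₂ (ringHomT Fq) ξ P

/-- The height of `P(X) ∈ (F_q[T])[X]`: the maximum of the absolute values of its
coefficients.  A nonzero `c ∈ F_q[T]` has `|c| = q^{deg c}`, so for `P ≠ 0` the height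
is `q` raised to the maximal degree of a (nonzero) coefficient of `P`. -/
def heightP (q : ℕ) (P : Polynomial (Polynomial Fq)) : ℝ :=
  if P = 0 then 0 else (q : ℝ) ^ (P.support.sup fun i => (P.coeff i).natDegree)

/-- `w_n(ξ)`: the supremum (in the extended reals) of the real numbers `w` such that
`0 < |P(ξ)| ≤ H(P)^{-w}` for infinitely many `P(X) ∈ (F_q[T])[X]` of degree at most `n`. -/
def wn (q : ℕ) (n : ℕ) (ξ : LaurentSeries Fq) : EReal :=
  sSup ((fun w : ℝ => (w : EReal)) ''
    {w : ℝ | {P : Polynomial (Polynomial Fq) | P.natDegree ≤ n ∧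
      0 < absL Fq q (evalP Fq ξ P) ∧
      absL Fq q (evalP Fq ξ P) ≤ heightP Fq q P ^ (-w)}.Infinite})

/-- `w(ξ) = limsup_{n→∞} w_n(ξ)/n`. -/
def wB (q : ℕ) (ξ : LaurentSeries Fq) : EReal :=
  Filter.limsup (fun n : ℕ => wn Fq q n ξ / (n : EReal)) Filter.atTop

/-- `ξ` is an `A`-number if `w(ξ) = 0`. -/
def IsANumber (q : ℕ) (ξ : LaurentSeries Fq) : Prop := wB Fq q ξ = 0

/-- `ξ` is an `S`-number if `0 < w(ξ) < +∞`. -/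
def IsSNumber (q : ℕ) (ξ : LaurentSeries Fq) : Prop := 0 < wB Fq q ξ ∧ wB Fq q ξ < ⊤

/-- `ξ` is a `T`-number if `w(ξ) = +∞` and `w_n(ξ) < +∞` for all `n ≥ 1`. -/
def IsTNumber (q : ℕ) (ξ : LaurentSeries Fq) : Prop :=
  wB Fq q ξ = ⊤ ∧ ∀ n : ℕ, 1 ≤ n → wn Fq q n ξ < ⊤

/-- `ξ` is a `U`-number if `w(ξ) = +∞` and `w_n(ξ) = +∞` for some `n ≥ 1`. -/
def IsUNumber (q : ℕ) (ξ : LaurentSeries Fq) : Prop :=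
  wB Fq q ξ = ⊤ ∧ ∃ n : ℕ, 1 ≤ n ∧ wn Fq q n ξ = ⊤

/-- The type `t(ξ) = limsup_{n→∞} (log w_n(ξ))/(log n)` of a `T`-number (as an
extended real; for a `T`-number each `w_n(ξ)` is a finite real, recovered by `toReal`). -/
def typeT (q : ℕ) (ξ : LaurentSeries Fq) : EReal :=
  Filter.limsup
    (fun n : ℕ => ((Real.log (wn Fq q n ξ).toReal / Real.log n : ℝ) : EReal)) Filter.atTop

/-! ### The algebraic closure side -/

/-- The algebraic closure of `F_q((T⁻¹))`. -/
abbrev AC := AlgebraicClosure (LaurentSeries Fq)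

/-- The canonical embedding of `F_q((T⁻¹))` into its algebraic closure. -/
def iota : LaurentSeries Fq →+* AC Fq := algebraMap _ _

/-- The embedding `F_q[T] → AC`. -/
def ringHomTC : Polynomial Fq →+* AC Fq := (iota Fq).comp (ringHomT Fq)

/-- Evaluation of `P(X) ∈ (F_q[T])[X]` at an element of the algebraic closure. -/
def evalPC (α : AC Fq) (P : Polynomial (Polynomial Fq)) : AC Fq :=
  Polynomial.eval₂ (ringHomTC Fq) α P

/-- `P ∈ (F_q[T])[X]` is *the* minimal polynomial of `α`: it is non-constant, irreducible,
primitive, its leading coefficient is monic (in `T`), and `P(α) = 0`.  For `α` algebraic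
over `F_q(T)` such a polynomial exists and is unique. -/
def IsMinPolyOf (α : AC Fq) (P : Polynomial (Polynomial Fq)) : Prop :=
  0 < P.natDegree ∧ Irreducible P ∧ P.IsPrimitive ∧ P.leadingCoeff.Monic ∧ evalPC Fq α P = 0

/-- `α` is algebraic over `F_q(T)`. -/
def IsAlgT (α : AC Fq) : Prop := ∃ P, IsMinPolyOf Fq α P

/-- The degree of an algebraic `α`: the degree of its minimal polynomial. -/
def degT (α : AC Fq) : ℕ := if h : IsAlgT Fq α then h.choose.natDegree else 0

/-- The height of an algebraic `α`: the height of its minimal polynomial. -/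
def heightT (q : ℕ) (α : AC Fq) : ℝ := if h : IsAlgT Fq α then heightP Fq q h.choose else 0

/-- The unique extension of the absolute value to the algebraic closure of `F_q((T⁻¹))`,
given by the standard formula `|x| = |N_{K(x)/K}(x)|^{1/[K(x):K]}`, i.e.
`|x| = |c₀|^{1/d}` where `c₀` is the constant coefficient and `d` the degree of the
minimal polynomial of `x` over `K = F_q((T⁻¹))`. -/
def absC (q : ℕ) (x : AC Fq) : ℝ :=
  absL Fq q ((minpoly (LaurentSeries Fq) x).coeff 0) ^
    (((minpoly (LaurentSeries Fq) x).natDegree : ℝ)⁻¹)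

/-- `w_n^*(ξ)`: the supremum (in the extended reals) of the real numbers `w` such that
`0 < |ξ - α| ≤ H(α)^{-w-1}` for infinitely many `α` algebraic over `F_q(T)` of degree
at most `n`. -/
def wnStar (q : ℕ) (n : ℕ) (ξ : LaurentSeries Fq) : EReal :=
  sSup ((fun w : ℝ => (w : EReal)) ''
    {w : ℝ | {α : AC Fq | IsAlgT Fq α ∧ degT Fq α ≤ n ∧
      0 < absC Fq q (iota Fq ξ - α) ∧
      absC Fq q (iota Fq ξ - α) ≤ heightT Fq q α ^ (-w - 1)}.Infinite})

/-- `w^*(ξ) = limsup_{n→∞} w_n^*(ξ)/n`. -/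
def wBStar (q : ℕ) (ξ : LaurentSeries Fq) : EReal :=
  Filter.limsup (fun n : ℕ => wnStar Fq q n ξ / (n : EReal)) Filter.atTop

/-- `ξ` is an `A*`-number if `w^*(ξ) = 0`. -/
def IsAStarNumber (q : ℕ) (ξ : LaurentSeries Fq) : Prop := wBStar Fq q ξ = 0

/-- `ξ` is a `T*`-number if `w^*(ξ) = +∞` and `w_n^*(ξ) < +∞` for all `n ≥ 1`. -/
def IsTStarNumber (q : ℕ) (ξ : LaurentSeries Fq) : Prop :=
  wBStar Fq q ξ = ⊤ ∧ ∀ n : ℕ, 1 ≤ n → wnStar Fq q n ξ < ⊤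

/-- The `*`-type `t^*(ξ) = limsup_{n→∞} (log w_n^*(ξ))/(log n)` of a `T*`-number. -/
def typeTStar (q : ℕ) (ξ : LaurentSeries Fq) : EReal :=
  Filter.limsup
    (fun n : ℕ => ((Real.log (wnStar Fq q n ξ).toReal / Real.log n : ℝ) : EReal)) Filter.atTop

/-! ### The Laurent series `ξ(r, m)` -/

/-- `r_j = r^{m_0 m_1 ⋯ m_j}`. -/
def rr (r : ℕ) (m : ℕ → ℕ) (j : ℕ) : ℕ := r ^ (∏ i ∈ Finset.range (j + 1), m i)

/-- `α_j(r, m) = Σ_{n=1}^∞ T^{-r_j^n}`, i.e. the power series in `u = T⁻¹` whose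
`k`-th coefficient is `1` exactly when `k = r_j^n` for some `n ≥ 1`. -/
def alphaJ (r : ℕ) (m : ℕ → ℕ) (j : ℕ) : LaurentSeries Fq :=
  HahnSeries.ofPowerSeries ℤ Fq (PowerSeries.mk fun k =>
    if ∃ n : ℕ, 1 ≤ n ∧ k = rr r m j ^ n then 1 else 0)

/-- `ξ_a(r, m) = Σ_{j=0}^∞ a_j α_j(r, m)`, described coefficientwise: the coefficient of
`T^{-k}` is the (finite) sum over `j` of `a_j` times the coefficient of `T^{-k}` in
`α_j(r, m)`. -/
def xiA (r : ℕ) (m : ℕ → ℕ) (a : ℕ → ℕ) : LaurentSeries Fq :=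
  HahnSeries.ofPowerSeries ℤ Fq (PowerSeries.mk fun k =>
    ∑ᶠ j : ℕ, (a j : Fq) * (if ∃ n : ℕ, 1 ≤ n ∧ k = rr r m j ^ n then 1 else 0))

/-- `ξ(r, m) = Σ_{j=0}^∞ α_j(r, m)`. -/
def xi (r : ℕ) (m : ℕ → ℕ) : LaurentSeries Fq := xiA Fq r m fun _ => 1

/-! ### Algebraicity and algebraic dependence over `F_q(T)` for Laurent series -/

/-- `ξ ∈ F_q((T⁻¹))` is algebraic over `F_q(T)`. -/
def IsAlgLS (ξ : LaurentSeries Fq) : Prop :=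
  ∃ P : Polynomial (Polynomial Fq), P ≠ 0 ∧ evalP Fq ξ P = 0

/-- Evaluation of a two-variable polynomial `F(X, Y) ∈ (F_q[T])[X, Y]` (coded as an
iterated polynomial ring, `T` innermost, then `X`, then `Y`) at `(ξ, η)`. -/
def evalXY (ξ η : LaurentSeries Fq) (F : Polynomial (Polynomial (Polynomial Fq))) :
    LaurentSeries Fq :=
  Polynomial.eval₂ (Polynomial.eval₂RingHom (ringHomT Fq) ξ) η F

/-- `ξ` and `η` are algebraically dependent over `F_q(T)`. -/
def AlgDep (ξ η : LaurentSeries Fq) : Prop :=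
  ∃ F : Polynomial (Polynomial (Polynomial Fq)), F ≠ 0 ∧ evalXY Fq ξ η F = 0

/-- `deg_X` of `F(X, Y) ∈ (F_q[T])[X, Y]` in our encoding. -/
def degX (F : Polynomial (Polynomial (Polynomial Fq))) : ℕ :=
  F.support.sup fun i => (F.coeff i).natDegree

/-- `F(X, Y) ∈ (F_q[T])[X, Y]` is primitive (in `X` and `Y`): no non-unit of `F_q[T]`
divides all of its coefficients. -/
def IsPrimitiveXY (F : Polynomial (Polynomial (Polynomial Fq))) : Prop :=
  ∀ c : Polynomial Fq, (∀ i j : ℕ, c ∣ ((F.coeff i).coeff j)) → IsUnit c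

end OotoT

open OotoT

namespace OotoT

section Filtration

variable {Fq : Type} [Field Fq]

/-- The Laurent series of order at least `k`. -/
def filt (k : ℤ) : AddSubgroup (LaurentSeries Fq) where
  carrier := {x | ∀ i < k, x.coeff i = 0}
  zero_mem' := by simp
  add_mem' := by
    intro a b ha hb i hi
    simp [ha i hi, hb i hi]
  neg_mem' := by
    intro a ha i hi
    simp [ha i hi]

theorem filt_mono {a b : ℤ} (h : a ≤ b) {x : LaurentSeries Fq} (hx : x ∈ filt b) :
    x ∈ filt a := fun i hi => hx i (hi.trans_le h)

theorem mul_mem_filt {a b : ℤ} {x y : LaurentSeries Fq} (hx : x ∈ filt a) (hy : y ∈ filt b) :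
    x * y ∈ filt (a + b) := by
  intro i hi
  rw [HahnSeries.coeff_mul]
  refine Finset.sum_eq_zero fun ij hij => ?_
  simp only [Finset.mem_antidiagonal] at hij
  by_cases h1 : ij.1 < a
  · rw [hx _ h1, zero_mul]
  · by_cases h2 : ij.2 < b
    · rw [hy _ h2, mul_zero]
    · exfalso
      have := hij.2.2
      omega

theorem le_order_of_mem_filt {k : ℤ} {x : LaurentSeries Fq} (hx : x ∈ filt k) (h0 : x ≠ 0) :
    k ≤ x.order := by
  by_contra h
  exact (HahnSeries.coeff_order_eq_zero.not.mpr h0) (hx _ (by omega))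

theorem mem_filt_of_le_order {k : ℤ} {x : LaurentSeries Fq} (h : k ≤ x.order) : x ∈ filt k :=
  fun _ hi => HahnSeries.coeff_eq_zero_of_lt_order (hi.trans_le h)

theorem eq_zero_of_forall_mem_filt {x : LaurentSeries Fq} (h : ∀ N : ℕ, x ∈ filt (N : ℤ)) :
    x = 0 := by
  ext i
  exact h (i.toNat + 1) i (by push_cast; omega)

theorem single_mem_filt (k : ℤ) (c : Fq) : HahnSeries.single k c ∈ filt k := by
  intro i hi
  rw [HahnSeries.coeff_single_of_ne hi.ne]

theorem one_mem_filt : (1 : LaurentSeries Fq) ∈ filt 0 := single_mem_filt 0 1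

theorem pow_mem_filt {a : ℤ} {x : LaurentSeries Fq} (hx : x ∈ filt a) (n : ℕ) :
    x ^ n ∈ filt (n * a) := by
  induction n with
  | zero => simpa using one_mem_filt
  | succ n ih =>
    rw [pow_succ]
    have := mul_mem_filt ih hx
    push_cast
    rwa [add_one_mul]

theorem pow_mem_filt_zero {x : LaurentSeries Fq} (hx : x ∈ filt 0) (n : ℕ) : x ^ n ∈ filt 0 := by
  simpa using pow_mem_filt hx n

theorem pow_sub_pow_mem_filt {e : ℤ} {x y : LaurentSeries Fq} (hx : x ∈ filt 0) (hy : y ∈ filt 0)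
    (h : x - y ∈ filt e) (n : ℕ) : x ^ n - y ^ n ∈ filt e := by
  induction n with
  | zero => simp [zero_mem]
  | succ n ih =>
    have : x ^ (n + 1) - y ^ (n + 1) = x * (x ^ n - y ^ n) + (x - y) * y ^ n := by ring
    rw [this]
    have h1 := mul_mem_filt hx ih
    have h2 := mul_mem_filt h (pow_mem_filt_zero hy n)
    rw [zero_add] at h1
    rw [add_zero] at h2
    exact add_mem h1 h2

theorem eval_sub_eval_mem_filt {e H : ℤ} {x y : LaurentSeries Fq} (hx : x ∈ filt 0)
    (hy : y ∈ filt 0) (h : x - y ∈ filt e) {P : (LaurentSeries Fq)[X]}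
    (hP : ∀ i, P.coeff i ∈ filt (-H)) : P.eval x - P.eval y ∈ filt (e - H) := by
  rw [eval_eq_sum, eval_eq_sum, Polynomial.sum, Polynomial.sum, ← Finset.sum_sub_distrib]
  refine sum_mem fun i _ => ?_
  rw [← mul_sub, show e - H = -H + e by ring]
  exact mul_mem_filt (hP i) (pow_sub_pow_mem_filt hx hy h i)

/-! ### Polynomials in `T` inside the Laurent series -/

theorem Tel_eq : Tel Fq = HahnSeries.single (-1 : ℤ) (1 : Fq) := by
  unfold Tel
  rw [HahnSeries.inv_single, inv_one]

theorem single_pow_one (k : ℤ) (n : ℕ) :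
    (HahnSeries.single k (1 : Fq)) ^ n = HahnSeries.single (n * k : ℤ) (1 : Fq) := by
  rw [HahnSeries.single_pow, one_pow, nsmul_eq_mul]

theorem ringHomT_monomial (n : ℕ) (c : Fq) :
    ringHomT Fq (monomial n c) = HahnSeries.single (-(n : ℤ)) c := by
  simp only [ringHomT, coe_eval₂RingHom, eval₂_monomial, Tel_eq, single_pow_one]
  rw [HahnSeries.C_apply, HahnSeries.single_mul_single]
  simp

theorem coeff_ringHomT (f : Fq[X]) (n : ℕ) : (ringHomT Fq f).coeff (-(n : ℤ)) = f.coeff n := by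
  induction f using Polynomial.induction_on' with
  | add f g hf hg => simp [hf, hg]
  | monomial k c =>
    rw [ringHomT_monomial, coeff_monomial]
    by_cases h : k = n
    · simp [h]
    · rw [HahnSeries.coeff_single_of_ne (by omega), if_neg h]

theorem ringHomT_injective : Function.Injective (ringHomT Fq) := by
  intro f g h
  ext n
  rw [← coeff_ringHomT, ← coeff_ringHomT, h]

theorem ringHomT_mem_filt {f : Fq[X]} {B : ℕ} (h : f.natDegree ≤ B) :
    ringHomT Fq f ∈ filt (-(B : ℤ)) := by
  rw [f.as_sum_range, map_sum]
  refine sum_mem fun i hi => ?_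
  rw [ringHomT_monomial]
  refine filt_mono ?_ (single_mem_filt _ _)
  rw [Finset.mem_range] at hi
  omega

theorem natDegree_le_of_ringHomT_mem_filt {f : Fq[X]} {B : ℕ}
    (h : ringHomT Fq f ∈ filt (-(B : ℤ))) : f.natDegree ≤ B := by
  rw [natDegree_le_iff_coeff_eq_zero]
  intro N hN
  rw [← coeff_ringHomT]
  exact h _ (by omega)

theorem eq_zero_of_mem_range_of_mem_filt {x : LaurentSeries Fq} (hx : x ∈ (ringHomT Fq).range)
    (h : x ∈ filt 1) : x = 0 := by
  obtain ⟨f, rfl⟩ := hx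
  have : f = 0 := by
    ext n
    rw [← coeff_ringHomT]
    simpa using h _ (by omega)
  rw [this, map_zero]

theorem single_mem_range {k : ℤ} (hk : k ≤ 0) (c : Fq) :
    HahnSeries.single k c ∈ (ringHomT Fq).range :=
  ⟨monomial k.natAbs c, by
    rw [ringHomT_monomial, show -(k.natAbs : ℤ) = k by omega]⟩

/-- The images of the polynomials in `T` of degree at most `B`. -/
def box (B : ℤ) : AddSubgroup (LaurentSeries Fq) :=
  (ringHomT Fq).range.toAddSubgroup ⊓ filt (-B)

theorem mem_box {B : ℤ} {x : LaurentSeries Fq} :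
    x ∈ box B ↔ x ∈ (ringHomT Fq).range ∧ x ∈ filt (-B) := Iff.rfl

theorem box_mono {a b : ℤ} (h : a ≤ b) {x : LaurentSeries Fq} (hx : x ∈ box a) : x ∈ box b :=
  ⟨hx.1, filt_mono (by omega) hx.2⟩

theorem mul_mem_box {a b : ℤ} {x y : LaurentSeries Fq} (hx : x ∈ box a) (hy : y ∈ box b) :
    x * y ∈ box (a + b) :=
  ⟨(ringHomT Fq).range.mul_mem hx.1 hy.1, by
    rw [show -(a + b) = -a + -b by ring]; exact mul_mem_filt hx.2 hy.2⟩

theorem single_mem_box {k : ℤ} (hk : k ≤ 0) (c : Fq) : HahnSeries.single k c ∈ box (-k) :=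
  ⟨single_mem_range hk c, by simpa using single_mem_filt k c⟩

theorem one_mem_box : (1 : LaurentSeries Fq) ∈ box 0 := by
  have := single_mem_box (Fq := Fq) le_rfl 1
  simpa using this

theorem pow_mem_box {a : ℤ} {x : LaurentSeries Fq} (hx : x ∈ box a) (n : ℕ) :
    x ^ n ∈ box (n * a) :=
  ⟨(mem_box.1 hx).1 |> fun h => pow_mem h n, by
    rw [show -((n : ℤ) * a) = n * (-a) by ring]; exact pow_mem_filt hx.2 n⟩

end Filtration

section Liouville

variable {Fq : Type} [Field Fq]

/-- Polynomials whose `i`-th coefficient comes from a polynomial in `T` of degree at most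
`i * B`. -/
def boxSubring (B : ℤ) : Subring (LaurentSeries Fq)[X] where
  carrier := {f | ∀ i : ℕ, f.coeff i ∈ box (i * B)}
  zero_mem' := by simp [zero_mem]
  one_mem' := by
    intro i
    rw [coeff_one]
    split_ifs with h
    · subst h
      simpa using one_mem_box
    · exact zero_mem _
  add_mem' := by
    intro f g hf hg i
    rw [coeff_add]
    exact add_mem (hf i) (hg i)
  neg_mem' := by
    intro f hf i
    rw [coeff_neg]
    exact neg_mem (hf i)
  mul_mem' := by
    intro f g hf hg i
    rw [coeff_mul]
    refine sum_mem fun ij hij => ?_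
    rw [← Finset.HasAntidiagonal.mem_antidiagonal.1 hij]
    push_cast
    rw [add_mul]
    exact mul_mem_box (hf _) (hg _)

/-- A root of a polynomial in `boxSubring B` with constant coefficient `1` is not too large. -/
theorem order_le_of_eval_inv_eq_zero {B : ℤ} (hB : 0 ≤ B) {f : (LaurentSeries Fq)[X]}
    (hf : f ∈ boxSubring B) {d : ℕ} (hd : f.natDegree ≤ d) (h0 : f.coeff 0 = 1)
    {y : LaurentSeries Fq} (hy : y ≠ 0) (hroot : f.eval y⁻¹ = 0) :
    y.order ≤ (d - 1) * B := by
  by_contra! hlt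
  set k := f.natDegree with hk
  have hf0 : f ≠ 0 := by
    rintro rfl
    simp at h0
  have hk1 : 1 ≤ k := by
    by_contra hk0
    have hC := eq_C_of_natDegree_eq_zero (show f.natDegree = 0 by omega)
    rw [hC, eval_C, h0] at hroot
    exact one_ne_zero hroot
  have hsum : ∑ i ∈ Finset.range (k + 1), f.coeff i * y ^ (k - i) = 0 := by
    rw [eval_eq_sum_range, ← hk] at hroot
    calc ∑ i ∈ Finset.range (k + 1), f.coeff i * y ^ (k - i)
        = (∑ i ∈ Finset.range (k + 1), f.coeff i * y⁻¹ ^ i) * y ^ k := by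
          rw [Finset.sum_mul]
          refine Finset.sum_congr rfl fun i hi => ?_
          rw [Finset.mem_range] at hi
          rw [pow_sub₀ y hy (by omega), inv_pow]
          ring
      _ = 0 := by rw [hroot, zero_mul]
  rw [Finset.sum_range_succ, Nat.sub_self, pow_zero, mul_one] at hsum
  have hmem : f.coeff k ∈ filt 1 := by
    rw [eq_neg_of_add_eq_zero_right hsum]
    refine neg_mem (sum_mem fun i hi => ?_)
    rw [Finset.mem_range] at hi
    have h1 := mul_mem_filt (mem_box.1 (hf i)).2
      (pow_mem_filt (mem_filt_of_le_order (le_refl y.order)) (k - i))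
    refine filt_mono ?_ h1
    have e1 : (i : ℤ) * B ≤ (d - 1) * B := mul_le_mul_of_nonneg_right (by omega) hB
    have e0 : 0 ≤ (d - 1 : ℤ) * B := le_trans (by positivity) e1
    have e2 : y.order ≤ ((k - i : ℕ) : ℤ) * y.order :=
      le_mul_of_one_le_left (by omega) (by omega)
    omega
  have := eq_zero_of_mem_range_of_mem_filt (mem_box.1 (hf k)).1 hmem
  exact hf0 (leadingCoeff_eq_zero.1 this)

theorem order_le_of_mulVec_eq {ι : Type*} [Fintype ι] [DecidableEq ι] {B : ℤ} (hB : 0 ≤ B)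
    {A : Matrix ι ι (LaurentSeries Fq)} (hA : ∀ i j, A i j ∈ box B)
    {y : LaurentSeries Fq} (hy : y ≠ 0) {v : ι → LaurentSeries Fq} (hv : v ≠ 0)
    (h : A.mulVec v = y • v) : y.order ≤ (Fintype.card ι - 1) * B := by
  set f : (LaurentSeries Fq)[X] :=
    ((X : (LaurentSeries Fq)[X]) • (-A).map C + (1 : Matrix ι ι (LaurentSeries Fq)).map C).det
    with hf
  refine order_le_of_eval_inv_eq_zero hB (f := f) ?_ (natDegree_det_X_add_C_le _ _) ?_ hy ?_
  · rw [hf, Matrix.det_apply]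
    refine sum_mem fun σ _ => ?_
    rw [Units.smul_def, zsmul_eq_mul]
    refine mul_mem (intCast_mem _ _) (prod_mem fun i _ => ?_)
    simp only [Matrix.add_apply, Matrix.smul_apply, Matrix.map_apply, smul_eq_mul]
    refine add_mem ?_ ?_
    · intro n
      rw [X_mul, C_mul_X_eq_monomial, coeff_monomial]
      split_ifs with h1
      · subst h1
        simpa using hA (σ i) i
      · exact zero_mem _
    · rw [Matrix.one_apply]
      split_ifs
      · simp [one_mem]
      · simp [zero_mem]
  · rw [hf, coeff_zero_eq_eval_zero, ← coe_evalRingHom, RingHom.map_det]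
    rw [← Matrix.det_one (n := ι) (R := LaurentSeries Fq)]
    congr 1
    refine Matrix.ext fun i j => ?_
    by_cases hij : i = j <;> simp [Matrix.one_apply, hij]
  · rw [hf, ← coe_evalRingHom, RingHom.map_det]
    refine Matrix.exists_mulVec_eq_zero_iff.1 ⟨v, hv, ?_⟩
    have : (evalRingHom y⁻¹).mapMatrix
        ((X : (LaurentSeries Fq)[X]) • (-A).map C + (1 : Matrix ι ι (LaurentSeries Fq)).map C)
        = 1 - y⁻¹ • A := by
      refine Matrix.ext fun i j => ?_
      by_cases hij : i = j
      · simp [hij]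
        ring
      · simp [hij]
    rw [this, Matrix.sub_mulVec, Matrix.one_mulVec, Matrix.smul_mulVec, h, smul_smul,
      inv_mul_cancel₀ hy, one_smul, sub_self]

/-- The combinations `∑ a_l θ^l` with `l < R` and all `a_l` in `box B`. -/
def boxSpan (R : ℕ) (θ : LaurentSeries Fq) (B : ℤ) : AddSubgroup (LaurentSeries Fq) where
  carrier := {z | ∃ a : Fin R → LaurentSeries Fq, (∀ l, a l ∈ box B) ∧ z = ∑ l, a l * θ ^ (l : ℕ)}
  zero_mem' := ⟨0, fun _ => zero_mem _, by simp⟩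
  add_mem' := by
    rintro _ _ ⟨a, ha, rfl⟩ ⟨b, hb, rfl⟩
    exact ⟨a + b, fun l => add_mem (ha l) (hb l), by simp [add_mul, Finset.sum_add_distrib]⟩
  neg_mem' := by
    rintro _ ⟨a, ha, rfl⟩
    exact ⟨-a, fun l => neg_mem (ha l), by simp⟩

theorem mul_pow_mem_boxSpan {R l : ℕ} (hl : l < R) (θ : LaurentSeries Fq) {B : ℤ}
    {c : LaurentSeries Fq} (hc : c ∈ box B) : c * θ ^ l ∈ boxSpan R θ B := by
  refine ⟨Pi.single ⟨l, hl⟩ c, fun k => ?_, ?_⟩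
  · by_cases h : k = ⟨l, hl⟩
    · subst h
      simpa using hc
    · simp [h, zero_mem]
  · rw [Finset.sum_eq_single ⟨l, hl⟩]
    · simp
    · intro k _ hk
      simp [hk]
    · simp

/-- Liouville's inequality for a root `θ` of `X ^ R - X + b`. -/
theorem order_eval_le {R : ℕ} {θ b : LaurentSeries Fq} (hθ : θ ^ R = θ - b)
    (hb : HahnSeries.single (-(R : ℤ)) 1 * b ∈ box R) {H : ℕ} {P : (LaurentSeries Fq)[X]}
    (hdeg : P.natDegree < R) (hP : ∀ i, P.coeff i ∈ box H) (hne : P.eval θ ≠ 0) :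
    (P.eval θ).order ≤ (R - 1) * (H + R) + R := by
  set T : LaurentSeries Fq := HahnSeries.single (-(R : ℤ)) 1 with hT
  have hT0 : T ≠ 0 := by simp [hT]
  have hTbox : T ∈ box (R : ℤ) := by
    simpa [hT] using single_mem_box (Fq := Fq) (k := -(R : ℤ)) (by omega) 1
  have key : ∀ l : Fin R, T * P.eval θ * θ ^ (l : ℕ) ∈ boxSpan R θ (H + R) := by
    intro l
    rw [eval_eq_sum_range, Finset.mul_sum, Finset.sum_mul]
    refine sum_mem fun i hi => ?_
    rw [Finset.mem_range] at hi
    have hl := l.2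
    by_cases h : i + l < R
    · rw [show T * (P.coeff i * θ ^ i) * θ ^ (l : ℕ) = (P.coeff i * T) * θ ^ (i + l : ℕ) by ring]
      exact mul_pow_mem_boxSpan h _ (mul_mem_box (hP i) hTbox)
    · obtain ⟨s, hs⟩ := Nat.exists_eq_add_of_le (not_lt.1 h)
      have : T * (P.coeff i * θ ^ i) * θ ^ (l : ℕ)
          = (P.coeff i * T) * θ ^ (s + 1) - (P.coeff i * (T * b)) * θ ^ s := by
        rw [show T * (P.coeff i * θ ^ i) * θ ^ (l : ℕ) = (P.coeff i * T) * θ ^ (i + l : ℕ) by ring,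
          hs, pow_add, hθ]
        ring
      rw [this]
      exact sub_mem (mul_pow_mem_boxSpan (by omega) _ (mul_mem_box (hP i) hTbox))
        (mul_pow_mem_boxSpan (by omega) _ (mul_mem_box (hP i) hb))
  choose A hA hAeq using key
  have hR : 0 < R := by omega
  have hv : (fun l : Fin R => θ ^ (l : ℕ)) ≠ 0 := by
    intro h
    simpa using congrFun h ⟨0, hR⟩
  have hle := order_le_of_mulVec_eq (A := Matrix.of A) (B := H + R) (by positivity)
    (fun i j => hA i j) (mul_ne_zero hT0 hne) hv (by
      ext1 l
      rw [Pi.smul_apply, smul_eq_mul, hAeq l]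
      rfl)
  rw [HahnSeries.order_mul hT0 hne, hT, HahnSeries.order_single one_ne_zero, Fintype.card_fin] at hle
  linarith

/-- Translation by `ρ` maps polynomials of bounded height to polynomials of bounded height. -/
theorem coeff_comp_mem_box {n D H : ℕ} {ρ : LaurentSeries Fq}
    (hρD : HahnSeries.single (-(D : ℤ)) 1 * ρ ∈ box D) {P : (LaurentSeries Fq)[X]}
    (hdeg : P.natDegree ≤ n) (hP : ∀ i, P.coeff i ∈ box H) (k : ℕ) :
    (C (HahnSeries.single (-((n * D : ℕ) : ℤ)) (1 : Fq)) * P.comp (X + C ρ)).coeff k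
      ∈ box ((H + n * D : ℕ) : ℤ) := by
  set T : LaurentSeries Fq := HahnSeries.single (-(D : ℤ)) 1 with hT
  have hTbox : T ∈ box (D : ℤ) := by
    simpa [hT] using single_mem_box (Fq := Fq) (k := -(D : ℤ)) (by omega) 1
  have hTn : HahnSeries.single (-((n * D : ℕ) : ℤ)) (1 : Fq) = T ^ n := by
    rw [hT, single_pow_one]
    push_cast
    ring_nf
  rw [hTn, comp_eq_sum_left, Polynomial.sum_over_range' _ (by simp) (n + 1) (by omega),
    coeff_C_mul, finsetSum_coeff, Finset.mul_sum]
  refine sum_mem fun i hi => ?_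
  rw [Finset.mem_range] at hi
  rw [coeff_C_mul, coeff_X_add_C_pow]
  by_cases hk : k ≤ i
  · have : T ^ n * (P.coeff i * (ρ ^ (i - k) * (i.choose k : LaurentSeries Fq)))
        = i.choose k • (P.coeff i * ((T * ρ) ^ (i - k) * T ^ (n - (i - k)))) := by
      obtain ⟨s, hs⟩ := Nat.exists_eq_add_of_le (show i - k ≤ n by omega)
      rw [nsmul_eq_mul, hs, Nat.add_sub_cancel_left, pow_add, mul_pow]
      ring
    rw [this]
    refine nsmul_mem ?_ _
    have := mul_mem_box (hP i) (mul_mem_box (pow_mem_box hρD (i - k)) (pow_mem_box hTbox (n - (i - k))))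
    refine box_mono (le_of_eq ?_) this
    rw [← add_mul, ← Nat.cast_add, Nat.add_sub_cancel' (by omega)]
    push_cast
    ring
  · rw [Nat.choose_eq_zero_of_lt (by omega)]
    simp [zero_mem]

end Liouville

section Degree

variable {Fq : Type} [Field Fq]

/-- The polynomial `Z ^ R - T Z ^ (R - 1) + T` is irreducible by Eisenstein's criterion. -/
theorem irreducible_eisenstein {R : ℕ} (hR : 2 ≤ R) :
    (X ^ R - C (X : Fq[X]) * X ^ (R - 1) + C X : Fq[X][X]).Monic ∧
    (X ^ R - C (X : Fq[X]) * X ^ (R - 1) + C X : Fq[X][X]).natDegree = R ∧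
    Irreducible (X ^ R - C (X : Fq[X]) * X ^ (R - 1) + C X : Fq[X][X]) := by
  set E : Fq[X][X] := X ^ R - C (X : Fq[X]) * X ^ (R - 1) + C X with hE
  have hE' : E = X ^ R + (C X - C (X : Fq[X]) * X ^ (R - 1)) := by rw [hE]; ring
  have hlow : (C X - C (X : Fq[X]) * X ^ (R - 1) : Fq[X][X]).degree < R := by
    refine (degree_sub_le _ _).trans_lt (max_lt ?_ ?_)
    · exact degree_C_le.trans_lt (by exact_mod_cast (by omega : 0 < R))
    · exact (degree_C_mul_X_pow_le _ _).trans_lt (by exact_mod_cast (by omega : R - 1 < R))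
  have hmonic : E.Monic := by
    rw [hE']
    exact monic_X_pow_add hlow
  have hdeg : E.natDegree = R := by
    rw [hE']
    refine natDegree_eq_of_degree_eq_some ?_
    rw [degree_add_eq_left_of_degree_lt (by rwa [degree_X_pow]), degree_X_pow]
  refine ⟨hmonic, hdeg, ?_⟩
  have hcoeff : ∀ n, n < R → E.coeff n = if n = 0 then X else if n = R - 1 then -X else 0 := by
    intro n hn
    rw [hE, coeff_add, coeff_sub, coeff_X_pow, coeff_C_mul_X_pow, coeff_C, if_neg hn.ne]
    by_cases h0 : n = 0
    · subst h0
      rw [if_neg (by omega)]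
      simp
    · rw [if_neg h0, if_neg h0]
      split_ifs <;> simp
  have hEis : E.IsEisensteinAt (Ideal.span {(X : Fq[X])}) := by
    refine ⟨?_, ?_, ?_⟩
    · rw [hmonic.leadingCoeff, Ideal.mem_span_singleton]
      exact fun h => not_isUnit_X (isUnit_of_dvd_one h)
    · intro n hn
      rw [hdeg] at hn
      rw [hcoeff n hn, Ideal.mem_span_singleton]
      split_ifs <;> simp
    · rw [hcoeff 0 (by omega), if_pos rfl, Ideal.span_singleton_pow, Ideal.mem_span_singleton]
      intro h
      have h1 := (X_pow_dvd_iff.1 h) 1 (by norm_num)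
      simp at h1
  refine hEis.irreducible ?_ hmonic.isPrimitive (by omega)
  rw [Ideal.span_singleton_prime X_ne_zero]
  exact prime_X

open IntermediateField in
theorem finrank_adjoin_le {K L : Type*} [Field K] [Field L] [Algebra K L] {x : L} {f : K[X]}
    (hf : f ≠ 0) (hx : aeval x f = 0) {n : ℕ} (hn : f.natDegree ≤ n) :
    FiniteDimensional K K⟮x⟯ ∧ Module.finrank K K⟮x⟯ ≤ n := by
  have hintegral : IsIntegral K x := by
    rw [← isAlgebraic_iff_isIntegral]
    exact ⟨f, hf, hx⟩
  refine ⟨adjoin.finiteDimensional hintegral, ?_⟩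
  rw [adjoin.finrank hintegral]
  exact (natDegree_le_natDegree (minpoly.degree_le_of_ne_zero K x hf hx)).trans hn

open IntermediateField in
theorem not_isRoot_of_fractionField {K L : Type*} [Field K] [Field L] [Algebra Fq[X] K]
    [IsFractionRing Fq[X] K] [Algebra K L] {p : ℕ} [Fact p.Prime] [CharP L p]
    {u α θ ρ : L} (hu : u ≠ 0)
    (hTu : algebraMap K L (algebraMap Fq[X] K X) * u = 1)
    {R s n : ℕ} (hR : ∃ e, R = p ^ e) (hR2 : 2 ≤ R) (hs : 2 ≤ s)
    (hα : α ^ R = α - u ^ R) (hθ : ∃ b : K, θ ^ s = θ - algebraMap K L b)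
    (hρ : ρ ∈ (algebraMap K L).range) (hn : n * s < R)
    {P : K[X]} (hP : P ≠ 0) (hdeg : P.natDegree ≤ n) : aeval (θ + α + ρ) P ≠ 0 := by
  intro hroot
  obtain ⟨b, hb⟩ := hθ
  obtain ⟨ρ', rfl⟩ := hρ
  set t : K := algebraMap Fq[X] K X with ht
  set Y := α + u with hYdef
  have hu' : u = algebraMap K L t⁻¹ := by
    rw [map_inv₀]
    exact eq_inv_of_mul_eq_one_right hTu
  have hY : Y ^ R = Y - u := by
    obtain ⟨e, rfl⟩ := hR
    rw [hYdef, add_pow_char_pow, hα]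
    ring
  have hY0 : Y ≠ 0 := by
    intro h
    rw [h, zero_pow (by omega)] at hY
    exact hu (by simpa using hY.symm)
  obtain ⟨hmonic, hEdeg, hirr⟩ := irreducible_eisenstein (Fq := Fq) hR2
  have hirrK := (hmonic.irreducible_iff_irreducible_map_fraction_map (K := K)).1 hirr
  have hZ : aeval Y⁻¹ ((X ^ R - C (X : Fq[X]) * X ^ (R - 1) + C X : Fq[X][X]).map
      (algebraMap Fq[X] K)) = 0 := by
    simp only [Polynomial.map_add, Polynomial.map_sub, Polynomial.map_mul, Polynomial.map_pow,
      map_X, map_C, map_add, map_sub, map_mul, map_pow, aeval_X, aeval_C, ← ht]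
    have h1 : Y⁻¹ ^ R * Y = Y⁻¹ ^ (R - 1) := by
      conv_lhs => rw [show R = R - 1 + 1 by omega, pow_succ, mul_assoc, inv_mul_cancel₀ hY0, mul_one]
    have h2 : Y⁻¹ ^ R * Y ^ R = 1 := by rw [← mul_pow, inv_mul_cancel₀ hY0, one_pow]
    rw [hY] at h2
    linear_combination (-algebraMap K L t) * h2 + algebraMap K L t * h1 - Y⁻¹ ^ R * hTu
  have hmin := minpoly.eq_of_irreducible_of_monic hirrK hZ (hmonic.map _)
  have hintegral : IsIntegral K Y⁻¹ := ⟨_, hmonic.map _, hZ⟩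
  have hrankZ : Module.finrank K K⟮Y⁻¹⟯ = R := by
    rw [adjoin.finrank hintegral, ← hmin, hmonic.natDegree_map, hEdeg]
  obtain ⟨hfin1, hle1⟩ := finrank_adjoin_le hP hroot hdeg
  have hpoly : (X ^ s + (C b - X) : K[X]).natDegree = s ∧ (X ^ s + (C b - X) : K[X]) ≠ 0 := by
    have hlow : (C b - X : K[X]).degree < s := by
      refine (degree_sub_le _ _).trans_lt (max_lt ?_ ?_)
      · exact degree_C_le.trans_lt (by exact_mod_cast (by omega : 0 < s))
      · exact degree_X_le.trans_lt (by exact_mod_cast (by omega : 1 < s))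
    refine ⟨natDegree_eq_of_degree_eq_some ?_, (monic_X_pow_add hlow).ne_zero⟩
    rw [degree_add_eq_left_of_degree_lt (by rwa [degree_X_pow]), degree_X_pow]
  obtain ⟨hfin2, hle2⟩ := finrank_adjoin_le (x := θ) hpoly.2 (by simp [hb]) hpoly.1.le
  have hsub : K⟮Y⁻¹⟯ ≤ K⟮θ + α + algebraMap K L ρ'⟯ ⊔ K⟮θ⟯ := by
    rw [adjoin_simple_le_iff]
    refine inv_mem ?_
    have hYeq : Y = (θ + α + algebraMap K L ρ') - algebraMap K L ρ' - θ + algebraMap K L t⁻¹ := by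
      rw [hYdef, ← hu']
      ring
    rw [hYeq]
    refine add_mem (sub_mem (sub_mem ?_ (IntermediateField.algebraMap_mem _ _)) ?_)
      (IntermediateField.algebraMap_mem _ _)
    · exact (le_sup_left : K⟮θ + α + algebraMap K L ρ'⟯ ≤ _) (mem_adjoin_simple_self K _)
    · exact (le_sup_right : K⟮θ⟯ ≤ _) (mem_adjoin_simple_self K _)
  have h1 : R ≤ Module.finrank K ↥(K⟮θ + α + algebraMap K L ρ'⟯ ⊔ K⟮θ⟯) := by
    rw [← hrankZ]
    exact finrank_le_of_le_right hsub
  have h2 := finrank_sup_le K⟮θ + α + algebraMap K L ρ'⟯ K⟮θ⟯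
  have h3 := Nat.mul_le_mul hle1 hle2
  omega

theorem eval_ne_zero_of_natDegree_lt {p : ℕ} [Fact p.Prime] [CharP (LaurentSeries Fq) p]
    {α θ b ρ : LaurentSeries Fq} {R s n N D : ℕ} (hR : ∃ e, R = p ^ e) (hR2 : 2 ≤ R) (hs : 2 ≤ s)
    (hα : α ^ R = α - HahnSeries.single (R : ℤ) 1) (hθ : θ ^ s = θ - b)
    (hb : HahnSeries.single (-(N : ℤ)) 1 * b ∈ (ringHomT Fq).range)
    (hρ : HahnSeries.single (-(D : ℤ)) 1 * ρ ∈ (ringHomT Fq).range) (hn : n * s < R)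
    {P : Fq[X][X]} (hP : P ≠ 0) (hdeg : P.natDegree ≤ n) :
    (P.map (ringHomT Fq)).eval (θ + α + ρ) ≠ 0 := by
  let _ := (IsFractionRing.lift (K := FractionRing Fq[X]) (ringHomT_injective (Fq := Fq))).toAlgebra
  have hmap : ∀ f : Fq[X], algebraMap (FractionRing Fq[X]) (LaurentSeries Fq)
      (algebraMap Fq[X] (FractionRing Fq[X]) f) = ringHomT Fq f :=
    fun f => IsFractionRing.lift_algebraMap _ f
  have hT : ∀ k : ℕ, ringHomT Fq (X ^ k) = HahnSeries.single (-(k : ℤ)) 1 := by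
    intro k
    rw [← ringHomT_monomial, monomial_one_right_eq_X_pow]
  have hrange : ∀ (k : ℕ) (x : LaurentSeries Fq),
      HahnSeries.single (-(k : ℤ)) 1 * x ∈ (ringHomT Fq).range →
      ∃ y, algebraMap (FractionRing Fq[X]) (LaurentSeries Fq) y = x := by
    rintro k x ⟨f, hf⟩
    refine ⟨algebraMap Fq[X] _ f / algebraMap Fq[X] _ (X ^ k), ?_⟩
    rw [map_div₀, hmap, hmap, hf, hT, mul_div_cancel_left₀]
    simp
  obtain ⟨b', rfl⟩ := hrange _ _ hb
  have := not_isRoot_of_fractionField (K := FractionRing Fq[X]) (p := p) (ρ := ρ)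
    (u := HahnSeries.single (1 : ℤ) (1 : Fq)) (by simp) (by
      rw [hmap, ← pow_one X, hT, HahnSeries.single_mul_single]
      simp) hR hR2 hs (by simpa [single_pow_one] using hα) ⟨b', hθ⟩ (hrange _ _ hρ) hn
    (P := P.map (algebraMap Fq[X] (FractionRing Fq[X])))
    ((Polynomial.map_ne_zero_iff (IsFractionRing.injective _ _)).2 hP)
    (natDegree_map_le.trans hdeg)
  rw [aeval_def, eval₂_map] at this
  rw [eval_map]
  have hcomp : (algebraMap (FractionRing Fq[X]) (LaurentSeries Fq)).comp
      (algebraMap Fq[X] (FractionRing Fq[X])) = ringHomT Fq := RingHom.ext hmap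
  rwa [hcomp] at this

end Degree

section Exponents

/-- `m_0 m_1 ⋯ m_j`. -/
def mprod (m : ℕ → ℕ) (j : ℕ) : ℕ := ∏ i ∈ Finset.range (j + 1), m i

variable {m : ℕ → ℕ}

theorem mprod_succ (j : ℕ) : mprod m (j + 1) = mprod m j * m (j + 1) :=
  Finset.prod_range_succ _ _

theorem mprod_dvd {j k : ℕ} (h : j ≤ k) : mprod m j ∣ mprod m k :=
  Finset.prod_dvd_prod_of_subset _ _ _ (Finset.range_mono (by omega))

theorem lt_mprod (hm0 : m 0 = 1) (hm : ∀ j : ℕ, 1 ≤ j → 2 ≤ m j) (j : ℕ) : j < mprod m j := by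
  induction j with
  | zero => simp [mprod, hm0]
  | succ j ih =>
    rw [mprod_succ]
    nlinarith [hm (j + 1) (by omega)]

theorem rr_eq (r : ℕ) (j : ℕ) : rr r m j = r ^ mprod m j := rfl

theorem rr_succ (r : ℕ) (j : ℕ) : rr r m (j + 1) = rr r m j ^ m (j + 1) := by
  rw [rr_eq, rr_eq, mprod_succ, pow_mul]

theorem lt_rr (hm0 : m 0 = 1) (hm : ∀ j : ℕ, 1 ≤ j → 2 ≤ m j) {r : ℕ} (hr : 2 ≤ r) (j : ℕ) :
    j < rr r m j :=
  (lt_mprod hm0 hm j).trans (Nat.lt_pow_self (by omega))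

theorem two_le_rr (hm0 : m 0 = 1) (hm : ∀ j : ℕ, 1 ≤ j → 2 ≤ m j) {r : ℕ} (hr : 2 ≤ r) (j : ℕ) :
    2 ≤ rr r m j := by
  have h0 : mprod m j ≠ 0 := by
    have := lt_mprod hm0 hm j
    omega
  rw [rr_eq]
  exact hr.trans (Nat.le_self_pow h0 r)

theorem rr_sq_le (hm0 : m 0 = 1) (hm : ∀ j : ℕ, 1 ≤ j → 2 ≤ m j) {r : ℕ} (hr : 2 ≤ r) (j : ℕ) :
    rr r m j ^ 2 ≤ rr r m (j + 1) := by
  rw [rr_succ]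
  exact Nat.pow_le_pow_right (by have := two_le_rr hm0 hm hr j; omega) (hm _ (by omega))

theorem rr_eq_pow {r j k : ℕ} (h : j ≤ k) : ∃ d, rr r m k = rr r m j ^ d := by
  obtain ⟨d, hd⟩ := mprod_dvd (m := m) h
  exact ⟨d, by rw [rr_eq, rr_eq, ← pow_mul, ← hd]⟩

end Exponents

section Lacunary

variable {Fq : Type} [Field Fq]

/-- The truncation of a series supported on the powers of `S`. -/
def trunc (S N : ℕ) (x : LaurentSeries Fq) : LaurentSeries Fq :=
  ∑ n ∈ Finset.Icc 1 N, HahnSeries.single ((S ^ n : ℕ) : ℤ) (x.coeff ((S ^ n : ℕ) : ℤ))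

theorem sum_single_mem_filt_zero {ι : Type*} (s : Finset ι) (e : ι → ℕ) (c : ι → Fq) :
    ∑ i ∈ s, HahnSeries.single (e i : ℤ) (c i) ∈ filt 0 :=
  sum_mem fun _ _ => filt_mono (by positivity) (single_mem_filt _ _)

theorem single_mul_sum_single_mem_box {ι : Type*} {s : Finset ι} {e : ι → ℕ} {D : ℕ}
    (h : ∀ i ∈ s, e i ≤ D) (c : ι → Fq) :
    HahnSeries.single (-(D : ℤ)) 1 * ∑ i ∈ s, HahnSeries.single (e i : ℤ) (c i) ∈ box (D : ℤ) := by
  rw [Finset.mul_sum]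
  refine sum_mem fun i hi => ?_
  rw [HahnSeries.single_mul_single, one_mul]
  have := h i hi
  exact box_mono (by omega) (single_mem_box (by omega) _)

theorem trunc_mem_filt (S N : ℕ) (x : LaurentSeries Fq) : trunc S N x ∈ filt 0 :=
  sum_single_mem_filt_zero _ _ _

theorem single_mul_trunc_mem_box {S : ℕ} (hS : 2 ≤ S) (N : ℕ) (x : LaurentSeries Fq) :
    HahnSeries.single (-((S ^ N : ℕ) : ℤ)) 1 * trunc S N x ∈ box ((S ^ N : ℕ) : ℤ) :=
  single_mul_sum_single_mem_box (fun i hi =>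
    Nat.pow_le_pow_right (by omega) (Finset.mem_Icc.1 hi).2) _

theorem sub_trunc_mem_filt {S : ℕ} (hS : 2 ≤ S) {x : LaurentSeries Fq} (hx : x ∈ filt 0)
    (hsupp : ∀ k : ℕ, x.coeff k ≠ 0 → ∃ n, 1 ≤ n ∧ k = S ^ n) (N : ℕ) :
    x - trunc S N x ∈ filt ((S ^ (N + 1) : ℕ) : ℤ) := by
  intro i hi
  rcases lt_or_ge i 0 with h | h
  · exact sub_mem hx (trunc_mem_filt S N x) i h
  lift i to ℕ using h
  have hi' : i < S ^ (N + 1) := by exact_mod_cast hi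
  rw [HahnSeries.coeff_sub, trunc, HahnSeries.coeff_sum, sub_eq_zero]
  by_cases h0 : ∃ n, 1 ≤ n ∧ i = S ^ n
  · obtain ⟨n, hn, rfl⟩ := h0
    have hnN : n < N + 1 := (Nat.pow_lt_pow_iff_right (by omega)).1 hi'
    rw [Finset.sum_eq_single n]
    · simp
    · intro k _ hk
      refine HahnSeries.coeff_single_of_ne fun h => hk ?_
      exact (Nat.pow_right_injective hS (by exact_mod_cast h)).symm
    · intro h
      exact absurd (Finset.mem_Icc.2 ⟨hn, by omega⟩) h
  · rw [not_imp_comm.1 (hsupp i) h0]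
    refine (Finset.sum_eq_zero fun n hn => HahnSeries.coeff_single_of_ne fun h => h0 ?_).symm
    exact ⟨n, (Finset.mem_Icc.1 hn).1, by exact_mod_cast h⟩

/-- A series whose nonzero coefficients all equal `1` and sit at the powers of `S = p ^ e`
satisfies `x ^ S = x - T ^ (-S)`. -/
theorem lacunary_pow_eq {p e : ℕ} [Fact p.Prime] [CharP (LaurentSeries Fq) p] {S : ℕ}
    (hSp : S = p ^ e) (hS : 2 ≤ S)
    {x : LaurentSeries Fq} (hx : x ∈ filt 0)
    (hsupp : ∀ k : ℕ, x.coeff k ≠ 0 → ∃ n, 1 ≤ n ∧ k = S ^ n)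
    (hone : ∀ n, 1 ≤ n → x.coeff ((S ^ n : ℕ) : ℤ) = 1) :
    x ^ S = x - HahnSeries.single (S : ℤ) 1 := by
  have htrunc : ∀ N, trunc S N x = ∑ n ∈ Finset.Icc 1 N, HahnSeries.single ((S ^ n : ℕ) : ℤ) 1 := by
    intro N
    exact Finset.sum_congr rfl fun n hn => by rw [hone n (Finset.mem_Icc.1 hn).1]
  have hstep : ∀ N, trunc S (N + 1) x = HahnSeries.single (S : ℤ) 1 + trunc S N x ^ S := by
    intro N
    induction N with
    | zero => simp [htrunc, show S ≠ 0 by omega]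
    | succ N ih =>
      have hsucc : ∀ M, trunc S (M + 1) x
          = trunc S M x + HahnSeries.single ((S ^ (M + 1) : ℕ) : ℤ) 1 := by
        intro M
        rw [htrunc, Finset.sum_Icc_succ_top (by omega), ← htrunc]
      have hpow : trunc S (N + 1) x ^ S
          = trunc S N x ^ S + HahnSeries.single ((S ^ (N + 1 + 1) : ℕ) : ℤ) 1 := by
        rw [hsucc N, hSp, add_pow_char_pow, ← hSp, single_pow_one]
        rw [pow_succ' S (N + 1), Nat.cast_mul]
      rw [hpow, hsucc (N + 1), ih, add_assoc]
  rw [← sub_eq_zero]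
  refine eq_zero_of_forall_mem_filt fun N => ?_
  have h1 := sub_trunc_mem_filt hS hx hsupp N
  have h2 := sub_trunc_mem_filt hS hx hsupp (N + 1)
  have h3 : x ^ S - trunc S N x ^ S ∈ filt ((S ^ (N + 1) : ℕ) : ℤ) :=
    pow_sub_pow_mem_filt hx (trunc_mem_filt S N x) h1 S
  have h4 : x ^ S - (x - HahnSeries.single (S : ℤ) 1)
      = (x ^ S - trunc S N x ^ S) - (x - trunc S (N + 1) x) := by
    rw [hstep]
    ring
  rw [h4]
  have hN : N < S ^ (N + 1) := (Nat.lt_succ_self N).trans (Nat.lt_pow_self (by omega))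
  have hN2 : S ^ (N + 1) ≤ S ^ (N + 1 + 1) := Nat.pow_le_pow_right (by omega) (by omega)
  exact sub_mem (filt_mono (by exact_mod_cast hN.le) h3)
    (filt_mono (by exact_mod_cast hN.le.trans hN2) h2)

theorem iterate_pow_eq {p e : ℕ} [Fact p.Prime] [CharP (LaurentSeries Fq) p] {S : ℕ}
    (hSp : S = p ^ e) {x : LaurentSeries Fq} (hx : x ^ S = x - HahnSeries.single (S : ℤ) 1) (k : ℕ) :
    x ^ (S ^ k) = x - ∑ i ∈ Finset.Icc 1 k, HahnSeries.single ((S ^ i : ℕ) : ℤ) 1 := by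
  induction k with
  | zero => simp
  | succ k ih =>
    rw [pow_succ', pow_mul, hx, hSp, ← pow_mul, sub_pow_char_pow, pow_mul, ← hSp, ih,
      Finset.sum_Icc_succ_top (by omega), single_pow_one, sub_sub]
    congr 3

end Lacunary

section Series

variable {Fq : Type} [Field Fq] {r : ℕ} {m : ℕ → ℕ}

theorem charP_laurentSeries (p : ℕ) [CharP Fq p] : CharP (LaurentSeries Fq) p :=
  charP_of_injective_ringHom (f := (HahnSeries.C : Fq →+* LaurentSeries Fq))
    HahnSeries.C_injective p

theorem ofPowerSeries_mem_filt_zero (f : PowerSeries Fq) :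
    HahnSeries.ofPowerSeries ℤ Fq f ∈ filt 0 := by
  intro i hi
  have := PowerSeries.coeff_coe (f := f) i
  rwa [if_pos hi] at this

theorem alphaJ_coeff (j k : ℕ) : (alphaJ Fq r m j).coeff (k : ℤ)
    = if ∃ n : ℕ, 1 ≤ n ∧ k = rr r m j ^ n then 1 else 0 := by
  rw [alphaJ, HahnSeries.ofPowerSeries_apply_coeff, PowerSeries.coeff_mk]

theorem alphaJ_coeff_eq_zero (hm0 : m 0 = 1) (hm : ∀ j : ℕ, 1 ≤ j → 2 ≤ m j) (hr : 2 ≤ r)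
    {j k : ℕ} (h : k ≤ j) : (alphaJ Fq r m j).coeff (k : ℤ) = 0 := by
  rw [alphaJ_coeff, if_neg]
  rintro ⟨n, hn, rfl⟩
  have h1 := lt_rr hm0 hm hr j
  have h2 := Nat.le_self_pow (show n ≠ 0 by omega) (rr r m j)
  omega

theorem xi_coeff (hm0 : m 0 = 1) (hm : ∀ j : ℕ, 1 ≤ j → 2 ≤ m j) (hr : 2 ≤ r)
    {N k : ℕ} (h : k ≤ N) :
    (xi Fq r m).coeff (k : ℤ) = ∑ j ∈ Finset.range N, (alphaJ Fq r m j).coeff (k : ℤ) := by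
  rw [xi, xiA, HahnSeries.ofPowerSeries_apply_coeff, PowerSeries.coeff_mk,
    finsum_eq_sum_of_support_subset (s := Finset.range N)]
  · exact Finset.sum_congr rfl fun j _ => by rw [alphaJ_coeff, Nat.cast_one, one_mul]
  · intro j hj
    rw [Finset.coe_range, Set.mem_Iio]
    by_contra hjN
    refine hj ?_
    have := alphaJ_coeff_eq_zero (Fq := Fq) hm0 hm hr (show k ≤ j by omega)
    rw [alphaJ_coeff] at this
    simp only [Nat.cast_one, one_mul]
    exact this

theorem alphaJ_pow_eq {p e : ℕ} [Fact p.Prime] [CharP (LaurentSeries Fq) p] (hrp : r = p ^ e)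
    (hm0 : m 0 = 1) (hm : ∀ j : ℕ, 1 ≤ j → 2 ≤ m j) (hr : 2 ≤ r) (j : ℕ) :
    alphaJ Fq r m j ^ rr r m j = alphaJ Fq r m j - HahnSeries.single (rr r m j : ℤ) 1 := by
  refine lacunary_pow_eq (e := e * mprod m j) (by rw [rr_eq, hrp, pow_mul])
    (two_le_rr hm0 hm hr j) (ofPowerSeries_mem_filt_zero _) (fun k hk => ?_) fun n hn => ?_
  · rw [alphaJ_coeff] at hk
    exact (ite_ne_right_iff.1 hk).1
  · rw [alphaJ_coeff, if_pos ⟨n, hn, rfl⟩]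

variable (Fq r m) in
/-- The partial sum `α_0 + ⋯ + α_J`. -/
def theta (J : ℕ) : LaurentSeries Fq := ∑ j ∈ Finset.range (J + 1), alphaJ Fq r m j

variable (Fq r m) in
/-- The tail `α_{J+1} + α_{J+2} + ⋯`. -/
def eta (J : ℕ) : LaurentSeries Fq := xi Fq r m - theta Fq r m J

variable (Fq r m) in
/-- The element `θ - θ ^ r_J` of `F_q[T, T⁻¹]`, where `θ = α_0 + ⋯ + α_J`. -/
def thetaDefect (J : ℕ) : LaurentSeries Fq :=
  ∑ j ∈ Finset.range (J + 1), ∑ i ∈ Finset.Icc 1 (mprod m J / mprod m j),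
    HahnSeries.single ((rr r m j ^ i : ℕ) : ℤ) 1

theorem theta_add_eta (J : ℕ) : theta Fq r m J + eta Fq r m J = xi Fq r m :=
  add_sub_cancel _ _

theorem theta_succ (J : ℕ) : theta Fq r m (J + 1) = theta Fq r m J + alphaJ Fq r m (J + 1) :=
  Finset.sum_range_succ _ _

theorem theta_mem_filt (J : ℕ) : theta Fq r m J ∈ filt 0 :=
  sum_mem fun _ _ => ofPowerSeries_mem_filt_zero _

theorem xi_mem_filt : xi Fq r m ∈ filt 0 := ofPowerSeries_mem_filt_zero _

theorem eta_mem_filt (J : ℕ) : eta Fq r m J ∈ filt 0 := sub_mem xi_mem_filt (theta_mem_filt J)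

theorem rr_pow_div (r : ℕ) {j J : ℕ} (h : j ≤ J) :
    rr r m j ^ (mprod m J / mprod m j) = rr r m J := by
  rw [rr_eq, rr_eq, ← pow_mul, Nat.mul_div_cancel' (mprod_dvd h)]

theorem theta_pow_eq {p e : ℕ} [Fact p.Prime] [CharP (LaurentSeries Fq) p] (hrp : r = p ^ e)
    (hm0 : m 0 = 1) (hm : ∀ j : ℕ, 1 ≤ j → 2 ≤ m j) (hr : 2 ≤ r) (J : ℕ) :
    theta Fq r m J ^ rr r m J = theta Fq r m J - thetaDefect Fq r m J := by
  have hp : rr r m J = p ^ (e * mprod m J) := by rw [rr_eq, hrp, pow_mul]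
  rw [theta, hp, sum_pow_char_pow, ← hp, thetaDefect, ← Finset.sum_sub_distrib]
  refine Finset.sum_congr rfl fun j hj => ?_
  rw [← rr_pow_div r (Finset.mem_range_succ_iff.1 hj)]
  exact iterate_pow_eq (e := e * mprod m j) (by rw [rr_eq, hrp, pow_mul])
    (alphaJ_pow_eq hrp hm0 hm hr j) _

theorem single_mul_thetaDefect_mem_box (hm0 : m 0 = 1) (hm : ∀ j : ℕ, 1 ≤ j → 2 ≤ m j)
    (hr : 2 ≤ r) (J : ℕ) :
    HahnSeries.single (-(rr r m J : ℤ)) 1 * thetaDefect Fq r m J ∈ box (rr r m J : ℤ) := by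
  rw [thetaDefect, Finset.mul_sum]
  refine sum_mem fun j hj => single_mul_sum_single_mem_box (fun i hi => ?_) _
  rw [← rr_pow_div r (Finset.mem_range_succ_iff.1 hj)]
  have := two_le_rr hm0 hm hr j
  exact Nat.pow_le_pow_right (by omega) (Finset.mem_Icc.1 hi).2

theorem eta_coeff (hm0 : m 0 = 1) (hm : ∀ j : ℕ, 1 ≤ j → 2 ≤ m j) (hr : 2 ≤ r)
    {J N k : ℕ} (h : k ≤ N) (hJ : J < N) :
    (eta Fq r m J).coeff (k : ℤ)
      = ∑ j ∈ Finset.Ico (J + 1) N, (alphaJ Fq r m j).coeff (k : ℤ) := by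
  rw [eta, HahnSeries.coeff_sub, xi_coeff hm0 hm hr h, theta, HahnSeries.coeff_sum,
    Finset.sum_Ico_eq_sub _ hJ]

theorem exists_pow_of_eta_coeff_ne_zero (hm0 : m 0 = 1) (hm : ∀ j : ℕ, 1 ≤ j → 2 ≤ m j)
    (hr : 2 ≤ r) {J k : ℕ} (h : (eta Fq r m J).coeff (k : ℤ) ≠ 0) :
    ∃ n, 1 ≤ n ∧ k = rr r m (J + 1) ^ n := by
  rw [eta_coeff hm0 hm hr (le_max_left k (J + 1)) (by omega)] at h
  obtain ⟨j, hj, hne⟩ := Finset.exists_ne_zero_of_sum_ne_zero h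
  rw [alphaJ_coeff] at hne
  obtain ⟨n, hn, rfl⟩ := (ite_ne_right_iff.1 hne).1
  obtain ⟨d, hd⟩ := rr_eq_pow (m := m) (r := r) (Finset.mem_Ico.1 hj).1
  refine ⟨d * n, Nat.mul_pos (Nat.pos_of_ne_zero ?_) hn, by rw [hd, ← pow_mul]⟩
  rintro rfl
  have := two_le_rr hm0 hm hr j
  rw [hd, pow_zero] at this
  omega

theorem exists_pow_eq_rr_iff (hr : 2 ≤ r) {a j : ℕ} (ha : 1 ≤ a) :
    (∃ n : ℕ, 1 ≤ n ∧ r ^ a = rr r m j ^ n) ↔ mprod m j ∣ a := by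
  constructor
  · rintro ⟨n, _, h⟩
    rw [rr_eq, ← pow_mul] at h
    exact ⟨n, Nat.pow_right_injective hr h⟩
  · rintro ⟨n, rfl⟩
    exact ⟨n, Nat.pos_of_mul_pos_left ha, by rw [rr_eq, pow_mul]⟩

/-- The coefficient of the tail at `r_{J+1} ^ i` counts the `j > J` with
`m_0 ⋯ m_j ∣ m_0 ⋯ m_{J+1} i`. -/
theorem eta_coeff_pow (hm0 : m 0 = 1) (hm : ∀ j : ℕ, 1 ≤ j → 2 ≤ m j) (hr : 2 ≤ r)
    {J i c : ℕ} (hi : 1 ≤ i)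
    (h : ∀ j, J + 1 ≤ j → (mprod m j ∣ mprod m (J + 1) * i ↔ j < J + 1 + c)) :
    (eta Fq r m J).coeff ((rr r m (J + 1) ^ i : ℕ) : ℤ) = c := by
  have hpos : 1 ≤ mprod m (J + 1) * i :=
    Nat.mul_pos (Nat.zero_lt_of_lt (lt_mprod hm0 hm (J + 1))) hi
  rw [eta_coeff hm0 hm hr (le_max_left _ (J + 1 + c)) (by omega)]
  have hterm : ∀ j ∈ Finset.Ico (J + 1) (max (rr r m (J + 1) ^ i) (J + 1 + c)),
      (alphaJ Fq r m j).coeff ((rr r m (J + 1) ^ i : ℕ) : ℤ) = if j < J + 1 + c then 1 else 0 := by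
    intro j hj
    rw [alphaJ_coeff]
    refine if_congr ?_ rfl rfl
    rw [rr_eq r (J + 1), ← pow_mul, exists_pow_eq_rr_iff hr hpos, h j (Finset.mem_Ico.1 hj).1]
  rw [Finset.sum_congr rfl hterm, Finset.sum_boole]
  congr 1
  have : (Finset.Ico (J + 1) (max (rr r m (J + 1) ^ i) (J + 1 + c))).filter (· < J + 1 + c)
      = Finset.Ico (J + 1) (J + 1 + c) := by
    ext j
    simp only [Finset.mem_filter, Finset.mem_Ico]
    omega
  rw [this, Nat.card_Ico]
  omega

end Series

section UpperBound

variable {Fq : Type} [Field Fq] {r : ℕ} {m : ℕ → ℕ}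

/-- The exponent of the height: the maximal degree of a coefficient. -/
def heightExp (P : Polynomial (Polynomial Fq)) : ℕ :=
  P.support.sup fun i => (P.coeff i).natDegree

theorem natDegree_coeff_le_heightExp (P : Polynomial (Polynomial Fq)) (i : ℕ) :
    (P.coeff i).natDegree ≤ heightExp P := by
  by_cases h : P.coeff i = 0
  · simp [h]
  · exact Finset.le_sup (f := fun i => (P.coeff i).natDegree) (Polynomial.mem_support_iff.2 h)

theorem evalP_eq (ξ : LaurentSeries Fq) (P : Polynomial (Polynomial Fq)) :
    evalP Fq ξ P = (P.map (ringHomT Fq)).eval ξ := (Polynomial.eval_map _ _).symm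

theorem order_le_of_sub_mem_filt {x y : LaurentSeries Fq} {k : ℤ} (hx : x ≠ 0)
    (hk : x.order < k) (hxy : y - x ∈ filt k) : y ≠ 0 ∧ y.order ≤ x.order := by
  have h1 : y.coeff x.order = x.coeff x.order := by
    have := hxy _ hk
    rwa [HahnSeries.coeff_sub, sub_eq_zero] at this
  have h2 : y.coeff x.order ≠ 0 := h1 ▸ HahnSeries.coeff_order_eq_zero.not.2 hx
  refine ⟨?_, HahnSeries.order_le_of_coeff_ne_zero h2⟩
  rintro rfl
  exact h2 rfl

theorem exists_pow_between {S a : ℕ} (hS : 2 ≤ S) (ha : 2 ≤ a) :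
    ∃ M : ℕ, a ≤ S ^ M ∧ S ^ M ≤ S * a := by
  refine ⟨Nat.clog S a, Nat.le_pow_clog (by omega) a, ?_⟩
  have h0 := Nat.clog_pos (b := S) (by omega) ha
  have h1 := Nat.pow_pred_clog_lt_self (b := S) (by omega) (show 1 < a by omega)
  obtain ⟨c, hc⟩ : ∃ c, Nat.clog S a = c + 1 := ⟨Nat.clog S a - 1, by omega⟩
  rw [hc] at h1 ⊢
  rw [pow_succ']
  exact Nat.mul_le_mul_left _ h1.le

/-- `P(ξ)` does not vanish, and its order is bounded linearly in the height exponent of `P`. -/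
theorem evalP_xi_ne_zero_and_order_le {p e : ℕ} [Fact p.Prime] [CharP (LaurentSeries Fq) p] (hrp : r = p ^ e)
    (hm0 : m 0 = 1) (hm : ∀ j : ℕ, 1 ≤ j → 2 ≤ m j) (hr : 2 ≤ r) {j n : ℕ} (hn : n < rr r m j)
    {P : Polynomial (Polynomial Fq)} (hP : P ≠ 0) (hdeg : P.natDegree ≤ n) {R S h : ℕ}
    (hR : R = rr r m (j + 1)) (hS : S = rr r m (j + 2)) (hh : h = heightExp P) :
    evalP Fq (xi Fq r m) P ≠ 0 ∧ (evalP Fq (xi Fq r m) P).order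
      ≤ ((R + n * R * S) * h + (R ^ 2 + n * R * S * (R + 1)) : ℕ) := by
  have hs2 : 2 ≤ rr r m j := two_le_rr hm0 hm hr j
  have hsR : rr r m j ^ 2 ≤ R := hR ▸ rr_sq_le hm0 hm hr j
  have hRS : R ^ 2 ≤ S := by rw [hR, hS]; exact rr_sq_le hm0 hm hr (j + 1)
  have hR2 : 2 ≤ R := hR ▸ two_le_rr hm0 hm hr (j + 1)
  have hS2 : 2 ≤ S := hS ▸ two_le_rr hm0 hm hr (j + 2)
  have hnR : n + 2 ≤ R := by nlinarith
  obtain ⟨M, hM1, hM2⟩ := exists_pow_between hS2 (show 2 ≤ h + R + 1 by omega)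
  set D := S ^ M with hD
  set θ := theta Fq r m (j + 1) with hθ
  set η := eta Fq r m (j + 1) with hη
  set ρ := trunc S M η with hρ
  set Q := P.map (ringHomT Fq) with hQ
  have hQbox : ∀ i, Q.coeff i ∈ box (h : ℤ) := by
    intro i
    rw [hQ, Polynomial.coeff_map]
    refine mem_box.2 ⟨⟨_, rfl⟩, ringHomT_mem_filt ?_⟩
    exact hh ▸ natDegree_coeff_le_heightExp P i
  have hQdeg : Q.natDegree ≤ n := Polynomial.natDegree_map_le.trans hdeg
  have hρbox : HahnSeries.single (-(D : ℤ)) 1 * ρ ∈ box (D : ℤ) :=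
    single_mul_trunc_mem_box hS2 M η
  have hne : Q.eval (θ + ρ) ≠ 0 := by
    rw [hθ, theta_succ]
    refine eval_ne_zero_of_natDegree_lt (s := rr r m j) (R := R) (n := n) (N := rr r m j) (D := D)
      (b := thetaDefect Fq r m j) ⟨e * mprod m (j + 1), by rw [hR, rr_eq, hrp, pow_mul]⟩ hR2 hs2
      (hR ▸ alphaJ_pow_eq hrp hm0 hm hr (j + 1)) (theta_pow_eq hrp hm0 hm hr j)
      (mem_box.1 (single_mul_thetaDefect_mem_box hm0 hm hr j)).1 (mem_box.1 hρbox).1 ?_ hP hdeg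
    nlinarith
  have horder : (Q.eval (θ + ρ)).order ≤ R * (h + n * D + R) := by
    set Q' := Polynomial.C (HahnSeries.single (-((n * D : ℕ) : ℤ)) (1 : Fq))
      * Q.comp (Polynomial.X + Polynomial.C ρ) with hQ'
    have heval : Q'.eval θ = HahnSeries.single (-((n * D : ℕ) : ℤ)) 1 * Q.eval (θ + ρ) := by
      simp [hQ', Polynomial.eval_comp]
    have hsne : HahnSeries.single (-((n * D : ℕ) : ℤ)) (1 : Fq) ≠ 0 :=
      HahnSeries.single_ne_zero one_ne_zero
    have hdeg' : Q'.natDegree < R := by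
      refine lt_of_le_of_lt (Polynomial.natDegree_C_mul_le _ _) ?_
      refine lt_of_le_of_lt Polynomial.natDegree_comp_le ?_
      rw [Polynomial.natDegree_X_add_C]
      omega
    have := order_eval_le (R := R) (hR ▸ theta_pow_eq hrp hm0 hm hr (j + 1))
      (hR ▸ single_mul_thetaDefect_mem_box hm0 hm hr (j + 1)) hdeg'
      (coeff_comp_mem_box hρbox hQdeg hQbox) (by rw [heval]; exact mul_ne_zero hsne hne)
    rw [heval, HahnSeries.order_mul hsne hne, HahnSeries.order_single one_ne_zero] at this
    push_cast at this ⊢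
    nlinarith
  have hdiff : Q.eval (xi Fq r m) - Q.eval (θ + ρ) ∈ filt (((S ^ (M + 1) : ℕ) : ℤ) - h) := by
    refine eval_sub_eval_mem_filt xi_mem_filt (add_mem (theta_mem_filt _) (trunc_mem_filt _ _ _))
      ?_ fun i => (mem_box.1 (hQbox i)).2
    rw [← theta_add_eta (j + 1), add_sub_add_left_eq_sub]
    refine sub_trunc_mem_filt hS2 (eta_mem_filt _) (fun k hk => ?_) M
    rw [hS]
    exact exists_pow_of_eta_coeff_ne_zero hm0 hm hr hk
  have hlt : R * (h + n * D + R) + h < S ^ (M + 1) := by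
    have h1 : R * (n + 1) + 1 ≤ S := by nlinarith
    have h2 : (R * (n + 1) + 1) * D ≤ S * D := Nat.mul_le_mul_right _ h1
    rw [pow_succ', ← hD]
    nlinarith
  rw [evalP_eq]
  refine (order_le_of_sub_mem_filt hne ?_ hdiff).imp_right fun hle => hle.trans (horder.trans ?_)
  · have : ((R * (h + n * D + R) + h : ℕ) : ℤ) < (S ^ (M + 1) : ℕ) := by exact_mod_cast hlt
    push_cast at this horder ⊢
    linarith
  · have : n * R * D ≤ n * R * (S * (h + R + 1)) := Nat.mul_le_mul_left _ hM2
    have h3 : R * (h + n * D + R) ≤ (R + n * R * S) * h + (R ^ 2 + n * R * S * (R + 1)) := by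
      nlinarith
    exact_mod_cast h3

theorem finite_natDegree_le_heightExp_le [Finite Fq] (n B : ℕ) :
    {P : Polynomial (Polynomial Fq) | P.natDegree ≤ n ∧ heightExp P ≤ B}.Finite := by
  refine Set.Finite.of_injOn
    (f := fun P (i : Fin (n + 1)) (k : Fin (B + 1)) => (P.coeff i).coeff k) (t := Set.univ)
    (fun _ _ => Set.mem_univ _) ?_ Set.finite_univ
  rintro P ⟨hP1, hP2⟩ Q ⟨hQ1, hQ2⟩ hPQ
  ext i k
  by_cases hi : i < n + 1
  · by_cases hk : k < B + 1
    · exact congrFun (congrFun hPQ ⟨i, hi⟩) ⟨k, hk⟩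
    · have h1 := natDegree_coeff_le_heightExp P i
      have h2 := natDegree_coeff_le_heightExp Q i
      rw [Polynomial.coeff_eq_zero_of_natDegree_lt (by omega),
        Polynomial.coeff_eq_zero_of_natDegree_lt (by omega)]
  · rw [Polynomial.coeff_eq_zero_of_natDegree_lt (p := P) (by omega),
      Polynomial.coeff_eq_zero_of_natDegree_lt (p := Q) (by omega)]

/-- A linear bound for the order of `P(ξ)` in terms of the height exponent bounds `w_n(ξ)`. -/
theorem wn_le_of_order_le [Finite Fq] {q n A B : ℕ} (hq : 2 ≤ q) {ξ : LaurentSeries Fq}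
    (h : ∀ P : Polynomial (Polynomial Fq), P ≠ 0 → P.natDegree ≤ n →
      (evalP Fq ξ P).order ≤ (A * heightExp P + B : ℕ)) :
    wn Fq q n ξ ≤ ((A + 1 : ℝ) : EReal) := by
  refine sSup_le ?_
  rintro _ ⟨w, hw, rfl⟩
  refine EReal.coe_le_coe_iff.2 ?_
  obtain ⟨P, ⟨hdeg, hpos, hle⟩, hPnot⟩ :=
    (hw.sdiff (finite_natDegree_le_heightExp_le n B)).nonempty
  have hB : B < heightExp P := by
    by_contra hcon
    exact hPnot ⟨hdeg, not_lt.1 hcon⟩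
  have hev : evalP Fq ξ P ≠ 0 := by
    intro h0
    simp [absL, h0] at hpos
  have hP : P ≠ 0 := by
    rintro rfl
    simp [evalP] at hev
  have hq1 : (1 : ℝ) < q := by exact_mod_cast hq
  rw [absL, if_neg hev, heightP, if_neg hP, ← Real.rpow_intCast, ← Real.rpow_natCast,
    ← Real.rpow_mul (by positivity), Real.rpow_le_rpow_left_iff hq1] at hle
  have hord := h P hP hdeg
  have hord' : ((evalP Fq ξ P).order : ℝ) ≤ A * heightExp P + B := by exact_mod_cast hord
  have hB' : (B : ℝ) ≤ heightExp P := by exact_mod_cast hB.le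
  have hpos' : (0 : ℝ) < heightExp P := by exact_mod_cast Nat.zero_lt_of_lt hB
  change ((-(evalP Fq ξ P).order : ℤ) : ℝ) ≤ (heightExp P : ℝ) * -w at hle
  push_cast at hle
  refine le_of_mul_le_mul_left (a := (heightExp P : ℝ)) ?_ hpos'
  nlinarith

theorem wn_xi_le [Finite Fq] {p e : ℕ} [Fact p.Prime] [CharP (LaurentSeries Fq) p]
    (hrp : r = p ^ e) (hm0 : m 0 = 1) (hm : ∀ j : ℕ, 1 ≤ j → 2 ≤ m j) (hr : 2 ≤ r) {q j n : ℕ}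
    (hq : 2 ≤ q) (hn1 : 1 ≤ n) (hn : n < rr r m j) :
    wn Fq q n (xi Fq r m)
      ≤ ((2 * (n * rr r m (j + 1) * rr r m (j + 2)) : ℝ) : EReal) := by
  refine (wn_le_of_order_le hq fun P hP hdeg =>
    (evalP_xi_ne_zero_and_order_le hrp hm0 hm hr hn hP hdeg rfl rfl rfl).2).trans (EReal.coe_le_coe_iff.2 ?_)
  have h1 := two_le_rr hm0 hm hr (j + 1)
  have h2 := two_le_rr hm0 hm hr (j + 2)
  have h3 : rr r m (j + 1) + 1 ≤ n * rr r m (j + 1) * rr r m (j + 2) := by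
    calc rr r m (j + 1) + 1 ≤ 1 * rr r m (j + 1) * 2 := by omega
      _ ≤ n * rr r m (j + 1) * rr r m (j + 2) := by gcongr
  have h4 : (rr r m (j + 1) + 1 : ℝ) ≤ n * rr r m (j + 1) * rr r m (j + 2) := by exact_mod_cast h3
  push_cast
  linarith

end UpperBound

section LowerBound

variable {Fq : Type} [Field Fq] {r : ℕ} {m : ℕ → ℕ}

theorem le_wn {q n : ℕ} (hq : 2 ≤ q) {ξ : LaurentSeries Fq} {w : ℝ}
    {f : ℕ → Polynomial (Polynomial Fq)} (hf : Function.Injective f)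
    (hdeg : ∀ t, (f t).natDegree ≤ n) (hne : ∀ t, evalP Fq ξ (f t) ≠ 0)
    (hord : ∀ t, (heightExp (f t) : ℝ) * w ≤ (evalP Fq ξ (f t)).order) :
    (w : EReal) ≤ wn Fq q n ξ := by
  refine le_sSup ⟨w, ?_, rfl⟩
  refine (Set.infinite_range_of_injective hf).mono ?_
  rintro _ ⟨t, rfl⟩
  have hq1 : (1 : ℝ) < q := by exact_mod_cast hq
  have hP : f t ≠ 0 := by
    intro h0
    have := hne t
    simp [h0, evalP] at this
  have habs : absL Fq q (evalP Fq ξ (f t)) = (q : ℝ) ^ (-(evalP Fq ξ (f t)).order) :=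
    if_neg (hne t)
  refine ⟨hdeg t, ?_, ?_⟩
  · rw [habs]
    positivity
  · rw [habs, heightP, if_neg hP, ← Real.rpow_intCast, ← Real.rpow_natCast,
      ← Real.rpow_mul (by positivity), Real.rpow_le_rpow_left_iff hq1]
    change ((-(evalP Fq ξ (f t)).order : ℤ) : ℝ) ≤ (heightExp (f t) : ℝ) * -w
    push_cast
    linarith [hord t]

theorem wn_mono (q : ℕ) (ξ : LaurentSeries Fq) : Monotone fun n => wn Fq q n ξ := by
  intro a b hab
  refine sSup_le_sSup (Set.image_mono fun w hw => Set.Infinite.mono ?_ hw)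
  exact fun P hP => ⟨hP.1.trans hab, hP.2⟩

theorem heightExp_le {P : Polynomial (Polynomial Fq)} {B : ℕ}
    (h : ∀ i, (P.coeff i).natDegree ≤ B) : heightExp P ≤ B :=
  Finset.sup_le fun i _ => h i

theorem ringHomT_X_pow (n : ℕ) :
    ringHomT Fq (Polynomial.X ^ n) = HahnSeries.single (-(n : ℤ)) 1 := by
  rw [← Polynomial.monomial_one_right_eq_X_pow, ringHomT_monomial]

/-- Multiplying `(X - ρ) ^ R - (X - ρ) + b` by a power of `T` to clear the denominators, where
`θ ^ R = θ - b`. -/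
theorem exists_annihilating_shift {p e R D : ℕ} [Fact p.Prime] [CharP (LaurentSeries Fq) p]
    (hRp : R = p ^ e) (hR : 2 ≤ R) (hD : 1 ≤ D) {θ b ρ : LaurentSeries Fq} (hθ : θ ^ R = θ - b)
    (hb : HahnSeries.single (-(R : ℤ)) 1 * b ∈ box (R : ℤ))
    (hρ : HahnSeries.single (-(D : ℤ)) 1 * ρ ∈ box (D : ℤ)) :
    ∃ P : Polynomial (Polynomial Fq), P.natDegree ≤ R ∧ P.coeff R = Polynomial.X ^ (R * D) ∧
      heightExp P ≤ R * D ∧ ∀ δ, evalP Fq (θ + ρ + δ) P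
        = HahnSeries.single (-((R * D : ℕ) : ℤ)) 1 * (δ ^ R - δ) := by
  have hsplit : ∀ a : ℕ, a ≤ R * D → ∀ x : LaurentSeries Fq,
      HahnSeries.single (-(a : ℤ)) 1 * x ∈ box (a : ℤ) →
      HahnSeries.single (-((R * D : ℕ) : ℤ)) 1 * x ∈ box ((R * D : ℕ) : ℤ) := by
    intro a ha x hx
    have h1 := mul_mem_box (single_mem_box (k := (a : ℤ) - (R * D : ℕ)) (by omega) (1 : Fq)) hx
    rw [← mul_assoc, HahnSeries.single_mul_single, one_mul] at h1
    rwa [show (a : ℤ) - (R * D : ℕ) + -a = -((R * D : ℕ) : ℤ) by ring,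
      show -((a : ℤ) - (R * D : ℕ)) + a = ((R * D : ℕ) : ℤ) by ring] at h1
  have hρR : HahnSeries.single (-((R * D : ℕ) : ℤ)) 1 * ρ ^ R ∈ box ((R * D : ℕ) : ℤ) := by
    have h1 := pow_mem_box hρ R
    rw [mul_pow, single_pow_one] at h1
    rwa [Nat.cast_mul, ← mul_neg]
  have hmem : HahnSeries.single (-((R * D : ℕ) : ℤ)) 1 * (b + ρ - ρ ^ R)
      ∈ box ((R * D : ℕ) : ℤ) := by
    rw [mul_sub, mul_add]
    exact sub_mem (add_mem (hsplit R (by nlinarith) b hb) (hsplit D (by nlinarith) ρ hρ)) hρR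
  obtain ⟨⟨g, hg⟩, hgf⟩ := mem_box.1 hmem
  have hgdeg : g.natDegree ≤ R * D := natDegree_le_of_ringHomT_mem_filt (by rw [hg]; exact hgf)
  set c : Polynomial Fq := Polynomial.X ^ (R * D) with hc
  have hcdeg : c.natDegree ≤ R * D := Polynomial.natDegree_X_pow_le _
  refine ⟨Polynomial.C c * Polynomial.X ^ R - Polynomial.C c * Polynomial.X + Polynomial.C g,
    ?_, ?_, heightExp_le fun i => ?_, fun δ => ?_⟩
  · compute_degree!
    omega
  · simp [Polynomial.coeff_X, Polynomial.coeff_C, show R ≠ 0 by omega, show 1 ≠ R by omega]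
  · simp only [Polynomial.coeff_add, Polynomial.coeff_sub, Polynomial.coeff_C_mul,
      Polynomial.coeff_X_pow, Polynomial.coeff_X, Polynomial.coeff_C]
    refine (Polynomial.natDegree_add_le _ _).trans (max_le
      ((Polynomial.natDegree_sub_le _ _).trans (max_le ?_ ?_)) ?_)
    all_goals split_ifs <;> simp [hcdeg, hgdeg]
  · rw [evalP]
    simp only [Polynomial.eval₂_add, Polynomial.eval₂_sub, Polynomial.eval₂_mul,
      Polynomial.eval₂_C, Polynomial.eval₂_X_pow, Polynomial.eval₂_X, hg]
    rw [hc, ringHomT_X_pow, hRp, add_pow_char_pow, add_pow_char_pow, ← hRp, hθ]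
    ring

theorem exists_small_value {p e : ℕ} [Fact p.Prime] [CharP (LaurentSeries Fq) p] (hrp : r = p ^ e)
    (hm0 : m 0 = 1) (hm : ∀ j : ℕ, 1 ≤ j → 2 ≤ m j) (hr : 2 ≤ r) {J k : ℕ}
    (hk : (eta Fq r m J).coeff ((rr r m (J + 1) ^ (k + 1) : ℕ) : ℤ) = 0) :
    ∃ P : Polynomial (Polynomial Fq), P.natDegree ≤ rr r m J ∧
      P.coeff (rr r m J) = Polynomial.X ^ (rr r m J * rr r m (J + 1) ^ k) ∧
      heightExp P ≤ rr r m J * rr r m (J + 1) ^ k ∧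
      evalP Fq (xi Fq r m) P ∈
        filt (((rr r m (J + 1) ^ (k + 2) : ℕ) : ℤ) - (rr r m J * rr r m (J + 1) ^ k : ℕ)) := by
  set R := rr r m J with hR
  set S := rr r m (J + 1) with hS
  have hR2 : 2 ≤ R := two_le_rr hm0 hm hr J
  have hS2 : 2 ≤ S := two_le_rr hm0 hm hr (J + 1)
  have hRp : R = p ^ (e * mprod m J) := by rw [hR, rr_eq, hrp, pow_mul]
  set ρ := trunc S k (eta Fq r m J) with hρ
  have hδ : eta Fq r m J - ρ ∈ filt ((S ^ (k + 2) : ℕ) : ℤ) := by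
    have h1 : trunc S (k + 1) (eta Fq r m J) = ρ := by
      rw [trunc, Finset.sum_Icc_succ_top (by omega), hk, HahnSeries.single_eq_zero, add_zero, hρ,
        trunc]
    rw [← h1]
    exact sub_trunc_mem_filt hS2 (eta_mem_filt J)
      (fun i hi => exists_pow_of_eta_coeff_ne_zero hm0 hm hr hi) (k + 1)
  obtain ⟨P, hdeg, hlead, hheight, heval⟩ := exists_annihilating_shift hRp hR2
    (Nat.one_le_pow _ _ (by omega)) (theta_pow_eq hrp hm0 hm hr J)
    (single_mul_thetaDefect_mem_box hm0 hm hr J) (single_mul_trunc_mem_box hS2 k (eta Fq r m J))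
  refine ⟨P, hdeg, hlead, hheight, ?_⟩
  have hxi : xi Fq r m = theta Fq r m J + ρ + (eta Fq r m J - ρ) := by
    rw [← theta_add_eta J]
    ring
  rw [hxi, heval, sub_eq_neg_add ((S ^ (k + 2) : ℕ) : ℤ)]
  refine mul_mem_filt (single_mem_filt _ _) (sub_mem ?_ hδ)
  have hδ0 : eta Fq r m J - ρ ∈ filt 0 := filt_mono (by positivity) hδ
  have h2 := mul_mem_filt (pow_mem_filt_zero hδ0 (R - 1)) hδ
  rwa [zero_add, ← pow_succ, Nat.sub_add_cancel (by omega)] at h2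

/-- The coefficients of the tail vanish along an arithmetic progression of exponents. -/
theorem eta_coeff_pow_eq_zero {p : ℕ} [CharP Fq p] (hp : 2 ≤ p)
    (hm0 : m 0 = 1) (hm : ∀ j : ℕ, 1 ≤ j → 2 ≤ m j) (hr : 2 ≤ r) {J A : ℕ}
    (hA : mprod m (J + p) = mprod m (J + 1) * A) (t : ℕ) :
    (eta Fq r m J).coeff
      ((rr r m (J + 1) ^ (A * (1 + t * m (J + p + 1))) : ℕ) : ℤ) = 0 := by
  have hpos : 0 < mprod m (J + p) := Nat.zero_lt_of_lt (lt_mprod hm0 hm (J + p))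
  have hA0 : 0 < A := Nat.pos_of_mul_pos_left (hA ▸ hpos)
  rw [eta_coeff_pow (c := p) hm0 hm hr (Nat.mul_pos hA0 (by omega)), CharP.cast_eq_zero]
  intro j hj
  rw [← mul_assoc, ← hA]
  refine ⟨fun hdvd => ?_, fun hlt => (mprod_dvd (by omega)).mul_right _⟩
  by_contra hcon
  have h1 := (mprod_dvd (m := m) (show J + p + 1 ≤ j by omega)).trans hdvd
  rw [mprod_succ] at h1
  have h2 := Nat.dvd_of_mul_dvd_mul_left hpos h1
  have h3 := (Nat.dvd_add_left (Dvd.intro_left t rfl)).1 h2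
  have h4 := Nat.le_of_dvd one_pos h3
  have := hm (J + p + 1) (by omega)
  omega

theorem le_wn_xi {p e : ℕ} [Fact p.Prime] [CharP Fq p] [CharP (LaurentSeries Fq) p]
    (hrp : r = p ^ e) (hm0 : m 0 = 1) (hm : ∀ j : ℕ, 1 ≤ j → 2 ≤ m j) (hr : 2 ≤ r) {q : ℕ}
    (hq : 2 ≤ q) (J : ℕ) :
    (((rr r m (J + 1) : ℝ) ^ 2 / rr r m J - 1 : ℝ) : EReal)
      ≤ wn Fq q (rr r m J) (xi Fq r m) := by
  have hp : 2 ≤ p := (Fact.out : p.Prime).two_le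
  obtain ⟨A, hA⟩ := mprod_dvd (m := m) (show J + 1 ≤ J + p by omega)
  have hA0 : 0 < A :=
    Nat.pos_of_mul_pos_left (hA ▸ Nat.zero_lt_of_lt (lt_mprod hm0 hm (J + p)))
  set R := rr r m J with hR
  set S := rr r m (J + 1) with hS
  have hR2 : 2 ≤ R := two_le_rr hm0 hm hr J
  have hS2 : 2 ≤ S := two_le_rr hm0 hm hr (J + 1)
  have hRS : R ^ 2 ≤ S := rr_sq_le hm0 hm hr J
  have hk : ∀ t, ∃ k, A * (1 + t * m (J + p + 1)) = k + 1 := fun t =>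
    Nat.exists_eq_add_one.2 (Nat.mul_pos hA0 (by omega))
  choose k hk using hk
  have hkinj : Function.Injective k := by
    intro a b hab
    have h1 : A * (1 + a * m (J + p + 1)) = A * (1 + b * m (J + p + 1)) := by rw [hk, hk, hab]
    have h2 := Nat.eq_of_mul_eq_mul_left hA0 h1
    have h3 := hm (J + p + 1) (by omega)
    exact Nat.eq_of_mul_eq_mul_right (by omega) (Nat.add_left_cancel h2)
  have hex := fun t => exists_small_value (k := k t) hrp hm0 hm hr
    (hk t ▸ eta_coeff_pow_eq_zero (Fq := Fq) (r := r) hp hm0 hm hr hA t)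
  choose f hdeg hlead hheight hval using hex
  have hne : ∀ t, evalP Fq (xi Fq r m) (f t) ≠ 0 := by
    intro t
    have hlt : R < S := by nlinarith
    refine (evalP_xi_ne_zero_and_order_le (j := J + 1) hrp hm0 hm hr hlt ?_ (hdeg t)
      rfl rfl rfl).1
    intro h0
    have h1 := hlead t
    rw [h0, Polynomial.coeff_zero] at h1
    exact pow_ne_zero _ Polynomial.X_ne_zero h1.symm
  refine le_wn (f := f) hq ?_ hdeg hne fun t => ?_
  · intro a b hab
    have h1 := hlead a
    rw [hab, hlead b] at h1
    have h2 := congrArg Polynomial.natDegree h1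
    rw [Polynomial.natDegree_X_pow, Polynomial.natDegree_X_pow] at h2
    exact (hkinj (Nat.pow_right_injective hS2 (Nat.eq_of_mul_eq_mul_left (by omega) h2))).symm
  · have h1 := le_order_of_mem_filt (hval t) (hne t)
    have h2 : ((S ^ (k t + 2) : ℕ) : ℝ) - (R * S ^ k t : ℕ)
        ≤ (evalP Fq (xi Fq r m) (f t)).order := by exact_mod_cast h1
    have h3 : (heightExp (f t) : ℝ) ≤ R * (S : ℝ) ^ k t := by exact_mod_cast hheight t
    have hR0 : (0 : ℝ) < R := by positivity
    have h4 : (0 : ℝ) ≤ (S : ℝ) ^ 2 / R - 1 := by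
      rw [sub_nonneg, le_div_iff₀ hR0, one_mul]
      have : R ≤ S ^ 2 := by nlinarith
      exact_mod_cast this
    refine (mul_le_mul_of_nonneg_right h3 h4).trans (le_of_eq_of_le ?_ h2)
    push_cast
    field_simp
    ring

end LowerBound

section TypeBounds

variable {Fq : Type} [Field Fq] {r : ℕ} {m : ℕ → ℕ}

theorem rr_strictMono (hm0 : m 0 = 1) (hm : ∀ j : ℕ, 1 ≤ j → 2 ≤ m j) (hr : 2 ≤ r) :
    StrictMono (rr r m) := by
  refine strictMono_nat_of_lt_succ fun j => ?_
  have h1 := two_le_rr hm0 hm hr j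
  have h2 := rr_sq_le hm0 hm hr j
  nlinarith

theorem log_rr_succ (j : ℕ) :
    Real.log (rr r m (j + 1)) = m (j + 1) * Real.log (rr r m j) := by
  rw [rr_succ, Nat.cast_pow, Real.log_pow]

theorem half_le_wn_xi {p e : ℕ} [Fact p.Prime] [CharP Fq p] [CharP (LaurentSeries Fq) p]
    (hrp : r = p ^ e) (hm0 : m 0 = 1) (hm : ∀ j : ℕ, 1 ≤ j → 2 ≤ m j) (hr : 2 ≤ r) {q : ℕ}
    (hq : 2 ≤ q) (J : ℕ) :
    (((rr r m (J + 1) : ℝ) ^ 2 / (2 * rr r m J) : ℝ) : EReal)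
      ≤ wn Fq q (rr r m J) (xi Fq r m) := by
  refine le_trans (EReal.coe_le_coe_iff.2 ?_) (le_wn_xi hrp hm0 hm hr hq J)
  have h1 : (2 : ℝ) ≤ rr r m J := by exact_mod_cast two_le_rr hm0 hm hr J
  have h2 : (rr r m J : ℝ) ^ 2 ≤ rr r m (J + 1) := by exact_mod_cast rr_sq_le hm0 hm hr J
  have h3 : (2 : ℝ) ≤ (rr r m (J + 1) : ℝ) ^ 2 / rr r m J := by
    rw [le_div_iff₀ (by linarith)]
    nlinarith [sq_nonneg ((rr r m (J + 1) : ℝ) - 1)]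
  have h4 : (rr r m (J + 1) : ℝ) ^ 2 / (2 * rr r m J)
      = (rr r m (J + 1) : ℝ) ^ 2 / rr r m J / 2 := by rw [div_div, mul_comm]
  rw [h4]
  linarith

theorem wn_xi_pos {p e : ℕ} [Fact p.Prime] [CharP Fq p]
    [CharP (LaurentSeries Fq) p] (hrp : r = p ^ e) (hm0 : m 0 = 1)
    (hm : ∀ j : ℕ, 1 ≤ j → 2 ≤ m j) (hr : 2 ≤ r) {q : ℕ} (hq : 2 ≤ q) {n : ℕ}
    (hn : rr r m 0 ≤ n) : 0 < wn Fq q n (xi Fq r m) := by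
  refine lt_of_lt_of_le ?_ ((half_le_wn_xi hrp hm0 hm hr hq 0).trans (wn_mono q _ hn))
  have h1 : (0 : ℝ) < rr r m 0 := by exact_mod_cast Nat.zero_lt_of_lt (two_le_rr hm0 hm hr 0)
  have h2 : (0 : ℝ) < rr r m (0 + 1) := by
    exact_mod_cast Nat.zero_lt_of_lt (two_le_rr hm0 hm hr (0 + 1))
  exact EReal.coe_pos.2 (by positivity)

theorem wn_xi_ne_top [Finite Fq] {p e : ℕ} [Fact p.Prime]
    [CharP (LaurentSeries Fq) p] (hrp : r = p ^ e) (hm0 : m 0 = 1)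
    (hm : ∀ j : ℕ, 1 ≤ j → 2 ≤ m j) (hr : 2 ≤ r) {q : ℕ} (hq : 2 ≤ q) {n : ℕ}
    (hn : 1 ≤ n) : wn Fq q n (xi Fq r m) ≠ ⊤ :=
  ((wn_xi_le hrp hm0 hm hr hq hn (lt_rr hm0 hm hr n)).trans_lt (EReal.coe_lt_top _)).ne

theorem log_wn_xi_div_le [Finite Fq] {p e : ℕ} [Fact p.Prime] [CharP Fq p]
    [CharP (LaurentSeries Fq) p] (hrp : r = p ^ e) (hm0 : m 0 = 1)
    (hm : ∀ j : ℕ, 1 ≤ j → 2 ≤ m j) (hr : 2 ≤ r) {q : ℕ} (hq : 2 ≤ q) {n i : ℕ}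
    (hi : rr r m i ≤ n) (hn : n < rr r m (i + 1)) :
    Real.log (wn Fq q n (xi Fq r m)).toReal / Real.log n
      ≤ 2 * (m (i + 1) : ℝ) + 2 * ∏ l ∈ Finset.Icc (i + 1) (i + 1 + p), (m l : ℝ) := by
  have hp : 2 ≤ p := (Fact.out : p.Prime).two_le
  have hri := two_le_rr hm0 hm hr i
  have hpos : 0 < wn Fq q n (xi Fq r m) := wn_xi_pos hrp hm0 hm hr hq
    (((rr_strictMono hm0 hm hr).monotone (Nat.zero_le i)).trans hi)
  have htop : wn Fq q n (xi Fq r m) ≠ ⊤ := wn_xi_ne_top hrp hm0 hm hr hq (by omega)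
  have hle := EReal.toReal_le_toReal (wn_xi_le hrp hm0 hm hr hq (by omega) hn)
    (EReal.bot_lt_zero.trans hpos).ne' (EReal.coe_ne_top _)
  rw [EReal.toReal_coe] at hle
  have hlog := Real.log_le_log (EReal.toReal_pos hpos htop) hle
  have hn0 : (n : ℝ) ≠ 0 := by
    have : n ≠ 0 := by omega
    exact_mod_cast this
  have h0 : ∀ j, (rr r m j : ℝ) ≠ 0 := fun j => by
    have : rr r m j ≠ 0 := by
      have := two_le_rr hm0 hm hr j
      omega
    exact_mod_cast this
  rw [Real.log_mul two_ne_zero (mul_ne_zero (mul_ne_zero hn0 (h0 _)) (h0 _)),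
    Real.log_mul (mul_ne_zero hn0 (h0 _)) (h0 _), Real.log_mul hn0 (h0 _),
    log_rr_succ (i + 1 + 1), log_rr_succ (i + 1), log_rr_succ i] at hlog
  have hlog2 : Real.log 2 ≤ Real.log n :=
    Real.log_le_log two_pos (by exact_mod_cast hri.trans hi)
  have hlogn : 0 < Real.log n := lt_of_lt_of_le (Real.log_pos one_lt_two) hlog2
  have hlogr : Real.log (rr r m i) ≤ Real.log n :=
    Real.log_le_log (by exact_mod_cast Nat.zero_lt_of_lt hri) (by exact_mod_cast hi)
  have hm' : ∀ j, 1 ≤ j → (1 : ℝ) ≤ m j := fun j hj => by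
    have := hm j hj
    exact_mod_cast (by omega : 1 ≤ m j)
  set a : ℝ := (m (i + 1) : ℝ)
  set b : ℝ := (m (i + 1 + 1) : ℝ)
  set c : ℝ := (m (i + 1 + 1 + 1) : ℝ)
  have ha : 1 ≤ a := hm' _ (by omega)
  have hb : 1 ≤ b := hm' _ (by omega)
  have hc : 1 ≤ c := hm' _ (by omega)
  have hprod : a * b * c ≤ ∏ l ∈ Finset.Icc (i + 1) (i + 1 + p), (m l : ℝ) := by
    have h1 : a * b * c = ∏ l ∈ Finset.Icc (i + 1) (i + 1 + 2), (m l : ℝ) := by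
      rw [Finset.prod_Icc_succ_top (by omega), Finset.prod_Icc_succ_top (by omega),
        Finset.Icc_self, Finset.prod_singleton]
    rw [h1]
    have h2 := Nat.le_of_dvd (Finset.prod_pos fun l hl => ?_) (Finset.prod_dvd_prod_of_subset
      (Finset.Icc (i + 1) (i + 1 + 2)) (Finset.Icc (i + 1) (i + 1 + p)) m
      (Finset.Icc_subset_Icc_right (by omega)))
    · exact_mod_cast h2
    · have := hm l (by have := (Finset.mem_Icc.1 hl).1; omega)
      omega
  have hab : a * b ≤ a * b * c := le_mul_of_one_le_right (by positivity) hc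
  rw [div_le_iff₀ hlogn]
  have h1 : a * b * Real.log (rr r m i) ≤ a * b * Real.log n := by gcongr
  have h2 : a * b * c * Real.log (rr r m i) ≤ a * b * c * Real.log n := by gcongr
  have h3 : (2 + a * b + a * b * c) * Real.log n
      ≤ (2 * a + 2 * ∏ l ∈ Finset.Icc (i + 1) (i + 1 + p), (m l : ℝ)) * Real.log n := by
    refine mul_le_mul_of_nonneg_right ?_ hlogn.le
    linarith
  linarith

theorem le_log_wn_xi_div [Finite Fq] {p e : ℕ} [Fact p.Prime] [CharP Fq p]
    [CharP (LaurentSeries Fq) p] (hrp : r = p ^ e) (hm0 : m 0 = 1)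
    (hm : ∀ j : ℕ, 1 ≤ j → 2 ≤ m j) (hr : 2 ≤ r) {q : ℕ} (hq : 2 ≤ q) (J : ℕ) :
    2 * (m (J + 1) : ℝ) - 1
      ≤ Real.log (wn Fq q (rr r m J) (xi Fq r m)).toReal / Real.log (rr r m J)
        + Real.log 2 / Real.log (rr r m J) := by
  have hR := two_le_rr hm0 hm hr J
  have hR1 : (1 : ℝ) < rr r m J := by exact_mod_cast hR
  have hS0 : (0 : ℝ) < rr r m (J + 1) := by
    exact_mod_cast Nat.zero_lt_of_lt (two_le_rr hm0 hm hr (J + 1))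
  have hle := EReal.toReal_le_toReal (half_le_wn_xi hrp hm0 hm hr hq J) (EReal.coe_ne_bot _)
    (wn_xi_ne_top (Fq := Fq) hrp hm0 hm hr hq (by omega))
  rw [EReal.toReal_coe] at hle
  have hlog := Real.log_le_log (by positivity) hle
  rw [Real.log_div (by positivity) (by positivity), Real.log_mul two_ne_zero (by positivity),
    Real.log_pow, log_rr_succ] at hlog
  push_cast at hlog
  rw [← add_div, le_div_iff₀ (Real.log_pos hR1)]
  linarith

theorem le_typeT_xi [Finite Fq] {p e : ℕ} [Fact p.Prime] [CharP Fq p]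
    [CharP (LaurentSeries Fq) p] (hrp : r = p ^ e) (hm0 : m 0 = 1)
    (hm : ∀ j : ℕ, 1 ≤ j → 2 ≤ m j) (hr : 2 ≤ r) {q : ℕ} (hq : 2 ≤ q) :
    Filter.limsup (fun j : ℕ => ((2 * (m j : ℝ) - 1 : ℝ) : EReal)) Filter.atTop
      ≤ typeT Fq q (xi Fq r m) := by
  set u : ℕ → EReal := fun n =>
    ((Real.log (wn Fq q n (xi Fq r m)).toReal / Real.log n : ℝ) : EReal) with hu
  set ε : ℕ → EReal := fun j => ((Real.log 2 / Real.log (rr r m j) : ℝ) : EReal) with hε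
  have hrr : Filter.Tendsto (rr r m) Filter.atTop Filter.atTop :=
    (rr_strictMono hm0 hm hr).tendsto_atTop
  have hε0 : Filter.limsup ε Filter.atTop = 0 := by
    refine Filter.Tendsto.limsup_eq ?_
    have h1 : Filter.Tendsto (fun j => Real.log 2 / Real.log (rr r m j)) Filter.atTop (nhds 0) :=
      (Real.tendsto_log_atTop.comp (tendsto_natCast_atTop_atTop.comp hrr)).const_div_atTop _
    exact (continuous_coe_real_ereal.tendsto 0).comp h1
  rw [← Filter.limsup_nat_add _ 1]
  calc Filter.limsup (fun j : ℕ => ((2 * (m (j + 1) : ℝ) - 1 : ℝ) : EReal)) Filter.atTop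
      ≤ Filter.limsup (u ∘ rr r m + ε) Filter.atTop := by
        refine Filter.limsup_le_limsup (Filter.Eventually.of_forall fun j => ?_)
        rw [Pi.add_apply, Function.comp_apply, hu, hε, ← EReal.coe_add]
        exact EReal.coe_le_coe_iff.2 (le_log_wn_xi_div hrp hm0 hm hr hq j)
    _ ≤ Filter.limsup (u ∘ rr r m) Filter.atTop + Filter.limsup ε Filter.atTop :=
        EReal.limsup_add_le (Or.inr (by simp [hε0])) (Or.inr (by simp [hε0]))
    _ = Filter.limsup u (Filter.map (rr r m) Filter.atTop) := by rw [hε0, add_zero]; rfl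
    _ ≤ typeT Fq q (xi Fq r m) := Filter.limsup_le_limsup_of_le hrr

theorem typeT_xi_le [Finite Fq] {p e : ℕ} [Fact p.Prime] [CharP Fq p]
    [CharP (LaurentSeries Fq) p] (hrp : r = p ^ e) (hm0 : m 0 = 1)
    (hm : ∀ j : ℕ, 1 ≤ j → 2 ≤ m j) (hr : 2 ≤ r) {q : ℕ} (hq : 2 ≤ q) :
    typeT Fq q (xi Fq r m) ≤ Filter.limsup (fun j : ℕ =>
      ((2 * (m j : ℝ) + 2 * ∏ i ∈ Finset.Icc j (j + p), (m i : ℝ) : ℝ) : EReal))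
        Filter.atTop := by
  set v : ℕ → EReal := fun j =>
    ((2 * (m j : ℝ) + 2 * ∏ i ∈ Finset.Icc j (j + p), (m i : ℝ) : ℝ) : EReal) with hv
  have hex : ∀ n, ∃ j, n < rr r m j := fun n => ⟨n, lt_rr hm0 hm hr n⟩
  have hg : Filter.Tendsto (fun n => Nat.find (hex n)) Filter.atTop Filter.atTop := by
    refine Filter.tendsto_atTop.2 fun j => ?_
    filter_upwards [Filter.eventually_ge_atTop (rr r m j)] with n hn
    refine (Nat.le_find_iff _ _).2 fun i hi => not_lt.2 (le_trans ?_ hn)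
    exact (rr_strictMono hm0 hm hr).monotone hi.le
  calc typeT Fq q (xi Fq r m)
      ≤ Filter.limsup (v ∘ fun n => Nat.find (hex n)) Filter.atTop := by
        refine Filter.limsup_le_limsup ?_
        filter_upwards [Filter.eventually_ge_atTop (rr r m 0)] with n hn
        have h0 : Nat.find (hex n) ≠ 0 := by
          intro h
          have := Nat.find_spec (hex n)
          rw [h] at this
          omega
        obtain ⟨i, hi⟩ := Nat.exists_eq_add_one_of_ne_zero h0
        have h1 := Nat.find_spec (hex n)
        rw [hi] at h1
        have h2 : rr r m i ≤ n := not_lt.1 (Nat.find_min (hex n) (by omega))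
        rw [Function.comp_apply, hi, hv]
        exact EReal.coe_le_coe_iff.2 (log_wn_xi_div_le hrp hm0 hm hr hq h2 h1)
    _ = Filter.limsup v (Filter.map (fun n => Nat.find (hex n)) Filter.atTop) := rfl
    _ ≤ Filter.limsup v Filter.atTop := Filter.limsup_le_limsup_of_le hg

end TypeBounds

end OotoT

/-- `limsup_j (2 m_j − 1) ≤ t(ξ(r,m)) ≤ limsup_j (2 m_j + 2 m_j m_{j+1} ⋯ m_{j+p})`. -/
theorem type_bounds (p : ℕ) (hp : p.Prime) (q : ℕ) (hq : ∃ e : ℕ, 0 < e ∧ q = p ^ e)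
    (Fq : Type) [Field Fq] [Fintype Fq] [CharP Fq p] (hcard : Fintype.card Fq = q)
    (r : ℕ) (hr : ∃ e : ℕ, 0 < e ∧ r = p ^ e)
    (m : ℕ → ℕ) (hm0 : m 0 = 1) (hm : ∀ j : ℕ, 1 ≤ j → 2 ≤ m j) :
    Filter.limsup (fun j : ℕ => ((2 * (m j : ℝ) - 1 : ℝ) : EReal)) Filter.atTop
        ≤ typeT Fq q (xi Fq r m) ∧
      typeT Fq q (xi Fq r m)
        ≤ Filter.limsup (fun j : ℕ =>
            ((2 * (m j : ℝ) + 2 * ∏ i ∈ Finset.Icc j (j + p), (m i : ℝ) : ℝ) : EReal))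
          Filter.atTop := by
  obtain ⟨e, he, rfl⟩ := hq
  obtain ⟨d, hd, hrp⟩ := hr
  have : Fact p.Prime := ⟨hp⟩
  have : CharP (LaurentSeries Fq) p := charP_laurentSeries p
  have hq2 : 2 ≤ p ^ e := hp.two_le.trans (Nat.le_self_pow he.ne' p)
  have hr2 : 2 ≤ r := hrp ▸ hp.two_le.trans (Nat.le_self_pow hd.ne' p)
  exact ⟨le_typeT_xi hrp hm0 hm hr2 hq2, typeT_xi_le hrp hm0 hm hr2 hq2⟩
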